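/- arXiv:1210.0919 — 2 statements merged into one kernel-verified Lean document; each statement's English description precedes it below -/
import Mathlib

section
/- Let α, β be locally integrable and γ-periodic, set b(t) = β(t)·exp(∫_{t−1}^t α(s) ds), and suppose (−1)^m·b(t) ≥ (−1)^m·b_0 > 0 for almost every t, for some integer m and constant b_0. Let (λ_k)_{k≥1} be an ordered enumeration of the Floquet multipliers of (∗) (extended by zeros if there are only finitely many), let (ζ_k)_{k≥1} enumerate the complex roots of the characteristic equation ζ = −b_0·e^{−ζ}, counted with multiplicity and ordered so that Re ζ_1 ≥ Re ζ_2 ≥ Re ζ_3 ≥ ⋯, and set α_0 = (1/γ)·∫_0^γ α(s) ds and Q = exp(∫_0^γ |b(s)| ds). Then |λ_k| ≥ Q^{−(k−1)}·exp(−γ·α_0 + γ·Σ_{j=1}^k Re ζ_j) whenever k − m is even. In particular λ_k ≠ 0 for every k ≥ 1, i.e., there are infinitely many Floquet multipliers counted with multiplicity. -/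
open MeasureTheory

noncomputable section

abbrev I01 : Set ℝ := Set.Icc (-1 : ℝ) 0

abbrev CC := C(I01, ℂ)

/-- A complex-valued solution of `x'(t) = -α(t) x(t) - β(t) x(t-1)` on `[τ-1, T]`. -/
def IsSolutionC (a c : ℝ → ℝ) (τ T : ℝ) (x : ℝ → ℂ) : Prop :=
  ContinuousOn x (Set.Icc (τ - 1) T) ∧
  ∀ t ∈ Set.Icc τ T, x t = x τ - ∫ s in τ..t, ((a s : ℂ) * x s + (c s : ℂ) * x (s - 1))

/-- `M` is the monodromy operator of the `γ`-periodic delay equation. -/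
def IsMonodromy (a c : ℝ → ℝ) (γ : ℝ) (M : CC →L[ℂ] CC) : Prop :=
  ∀ (φ : CC) (x : ℝ → ℂ), IsSolutionC a c 0 γ x →
    (∀ θ : I01, x (θ : ℝ) = φ θ) → ∀ θ : I01, M φ θ = x (γ + (θ : ℝ))

/-- A Floquet multiplier: a nonzero eigenvalue of the monodromy operator. -/
def IsFloquetMult (M : CC →L[ℂ] CC) (μ : ℂ) : Prop :=
  μ ≠ 0 ∧ ∃ φ : CC, φ ≠ 0 ∧ M φ = μ • φ

/-- The generalized eigenspace `G_μ = ⋃ₙ ker (M - μ I)^n`. -/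
def genEig (M : CC →L[ℂ] CC) (μ : ℂ) : Submodule ℂ CC :=
  ⨆ n : ℕ, LinearMap.ker (((M - μ • (1 : CC →L[ℂ] CC)) ^ n : CC →L[ℂ] CC) : CC →ₗ[ℂ] CC)

/-- The algebraic multiplicity of `μ`. -/
def algMult (M : CC →L[ℂ] CC) (μ : ℂ) : ℕ :=
  Module.finrank ℂ (genEig M μ)

/-- An ordered enumeration `(Λ k)_{k ≥ 1}` of the Floquet multipliers with repetitions
according to algebraic multiplicity, extended by zeros if there are only finitely many. -/
def IsOrderedEnumExt (M : CC →L[ℂ] CC) (Λ : ℕ → ℂ) : Prop :=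
  (∀ k : ℕ, 1 ≤ k → ‖Λ (k + 1)‖ ≤ ‖Λ k‖) ∧
  (∀ k : ℕ, 1 ≤ k → Λ k = 0 ∨ IsFloquetMult M (Λ k)) ∧
  (∀ μ : ℂ, IsFloquetMult M μ → Nat.card {k : ℕ | 1 ≤ k ∧ Λ k = μ} = algMult M μ)

/-- The entire function `ζ ↦ ζ + b₀ e^{-ζ}`, whose zeros are the roots of the
characteristic equation `ζ = -b₀ e^{-ζ}`. -/
def charFun (b₀ : ℝ) : ℂ → ℂ := fun z => z + (b₀ : ℂ) * Complex.exp (-z)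

theorem charFun_analyticAt (b₀ : ℝ) (z : ℂ) : AnalyticAt ℂ (charFun b₀) z := by
  have h : Differentiable ℂ (charFun b₀) :=
    differentiable_id.add ((Complex.differentiable_exp.comp differentiable_neg).const_mul _)
  exact h.analyticAt z

/-- The multiplicity of `z` as a zero of `ζ + b₀ e^{-ζ}`. -/
def rootOrder (b₀ : ℝ) (z : ℂ) : ℕ∞ := analyticOrderAt (charFun b₀) z

/-- An enumeration `(ζ k)_{k ≥ 1}` of the roots of `ζ = -b₀ e^{-ζ}`, counted with
multiplicity, ordered so that the real parts are nonincreasing. -/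
def IsRootEnum (b₀ : ℝ) (ζ : ℕ → ℂ) : Prop :=
  (∀ k : ℕ, 1 ≤ k → (ζ (k + 1)).re ≤ (ζ k).re) ∧
  (∀ k : ℕ, 1 ≤ k → charFun b₀ (ζ k) = 0) ∧
  (∀ z : ℂ, charFun b₀ z = 0 →
    (Nat.card {k : ℕ | 1 ≤ k ∧ ζ k = z} : ℕ∞) = rootOrder b₀ z)

section Spectral

open Module Polynomial

variable {X : Type*} [NormedAddCommGroup X] [NormedSpace ℂ X]

theorem finiteDimensional_eigenspace_of_isCompactOperator [CompleteSpace X] {K : X →L[ℂ] X}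
    (hK : IsCompactOperator K) {μ : ℂ} (hμ : μ ≠ 0) :
    FiniteDimensional ℂ (End.eigenspace (K : End ℂ X) μ) := by
  have hinv : ∀ v ∈ End.eigenspace (K : End ℂ X) μ, (K : End ℂ X) v ∈
      End.eigenspace (K : End ℂ X) μ := fun v hv => by
    have h := End.mem_eigenspace_iff.1 hv
    rw [h]
    exact Submodule.smul_mem _ _ hv
  have hclosed : IsClosed (End.eigenspace (K : End ℂ X) μ : Set X) := by
    have : (End.eigenspace (K : End ℂ X) μ : Set X) = {x | K x = μ • x} := by
      ext x
      simp
    rw [this]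
    exact isClosed_eq K.continuous (continuous_const_smul μ)
  have := hclosed.completeSpace_coe
  have h := IsCompactOperator.restrict' (f := (K : X →ₗ[ℂ] X)) hK hinv
  have h2 := (h.smul (S := ℂ) μ⁻¹)
  refine FiniteDimensional.of_isCompactOperator_id (𝕜 := ℂ) ?_
  convert! h2 using 1
  ext x
  have hx := End.mem_eigenspace_iff.1 x.2
  have hx' : K (x : X) = μ • (x : X) := hx
  simp [hx', smul_smul, hμ]

theorem finiteDimensional_ker_pow_of_isCompactOperator [CompleteSpace X] {K : X →L[ℂ] X}
    (hK : IsCompactOperator K) {μ : ℂ} (hμ : μ ≠ 0) (p : ℕ) :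
    FiniteDimensional ℂ (LinearMap.ker (((K : End ℂ X) - μ • (1 : End ℂ X)) ^ p)) := by
  set S : End ℂ X := (K : End ℂ X) - μ • (1 : End ℂ X) with hS
  induction p with
  | zero =>
    have : LinearMap.ker (S ^ 0) = ⊥ := by
      rw [pow_zero]; exact LinearMap.ker_id
    rw [this]; infer_instance
  | succ p ih =>
    have h1 := finiteDimensional_eigenspace_of_isCompactOperator hK hμ
    rw [End.eigenspace_def, ← hS] at h1
    rw [← Submodule.fg_iff_finiteDimensional] at *
    refine Submodule.fg_of_fg_map_of_fg_inf_ker S ?_ ?_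
    · have : FiniteDimensional ℂ (LinearMap.ker (S ^ p)) := Module.Finite.iff_fg.2 ih
      have hle : Submodule.map S (LinearMap.ker (S ^ (p + 1))) ≤ LinearMap.ker (S ^ p) := by
        rintro _ ⟨x, hx, rfl⟩
        simpa [pow_succ] using hx
      exact Module.Finite.iff_fg.1 (Submodule.finiteDimensional_of_le hle)
    · have : FiniteDimensional ℂ (LinearMap.ker S) := Module.Finite.iff_fg.2 h1
      exact Module.Finite.iff_fg.1 (Submodule.finiteDimensional_of_le inf_le_right)

theorem exists_ker_pow_eq_of_isCompactOperator [CompleteSpace X] {K : X →L[ℂ] X}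
    (hK : IsCompactOperator K) {μ : ℂ} (hμ : μ ≠ 0) :
    ∃ p : ℕ, LinearMap.ker (((K : End ℂ X) - μ • (1 : End ℂ X)) ^ p) =
      LinearMap.ker (((K : End ℂ X) - μ • (1 : End ℂ X)) ^ (p + 1)) := by
  set S : End ℂ X := (K : End ℂ X) - μ • (1 : End ℂ X) with hS
  have hSx : ∀ x, K x = S x + μ • x := fun x => by simp [hS]
  by_contra! hne
  have hmono : Monotone fun p => LinearMap.ker (S ^ p) := by
    refine monotone_nat_of_le_succ fun p x hx => ?_
    rw [LinearMap.mem_ker] at hx ⊢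
    rw [pow_succ', Module.End.mul_apply, hx, map_zero]
  have key : ∀ p, ∃ x ∈ LinearMap.ker (S ^ (p + 1)), ‖x‖ ≤ 3 ∧
      ∀ y ∈ LinearMap.ker (S ^ p), 1 ≤ ‖x - y‖ := by
    intro p
    have hfd := finiteDimensional_ker_pow_of_isCompactOperator hK hμ p
    rw [← hS] at hfd
    set W := LinearMap.ker (S ^ (p + 1))
    let F : Subspace ℂ W := (LinearMap.ker (S ^ p)).comap W.subtype
    have hF : IsClosed (F : Set W) :=
      (LinearMap.ker (S ^ p)).closed_of_finiteDimensional.preimage continuous_subtype_val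
    have hex : ∃ x : W, x ∉ F := by
      by_contra! hall
      exact hne p (le_antisymm (hmono p.le_succ) fun x hx => hall ⟨x, hx⟩)
    obtain ⟨x, hx, hxy⟩ := riesz_lemma_of_norm_lt (c := (2 : ℂ)) (R := 3) (by simp)
      (by simp; norm_num) hF hex
    refine ⟨x, x.2, hx, fun y hy => ?_⟩
    exact hxy ⟨y, hmono p.le_succ hy⟩ hy
  choose f hfmem hfnorm hffar using key
  have hsep : ∀ m n, m < n → ‖μ‖ ≤ ‖K (f n) - K (f m)‖ := by
    intro m n hmn
    have hm : f m ∈ LinearMap.ker (S ^ n) := hmono (Nat.succ_le_of_lt hmn) (hfmem m)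
    have hSn : S (f n) ∈ LinearMap.ker (S ^ n) := by
      have := hfmem n
      rw [LinearMap.mem_ker, pow_succ] at this
      exact this
    have hSm : S (f m) ∈ LinearMap.ker (S ^ n) := by
      rw [LinearMap.mem_ker, ← Module.End.mul_apply, ← pow_succ, pow_succ', Module.End.mul_apply,
        LinearMap.mem_ker.1 hm, map_zero]
    have hy : -(μ⁻¹ • (S (f n) - S (f m) - μ • f m)) ∈ LinearMap.ker (S ^ n) :=
      Submodule.neg_mem _ (Submodule.smul_mem _ _ (Submodule.sub_mem _ (Submodule.sub_mem _ hSn hSm)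
        (Submodule.smul_mem _ _ hm)))
    have h1 := hffar n _ hy
    have h2 : K (f n) - K (f m) = μ • (f n - -(μ⁻¹ • (S (f n) - S (f m) - μ • f m))) := by
      rw [sub_neg_eq_add, smul_add, smul_inv_smul₀ hμ, hSx, hSx]
      abel
    rw [h2, norm_smul]
    exact le_mul_of_one_le_right (norm_nonneg _) h1
  obtain ⟨C, hC, hC'⟩ := hK.image_closedBall_subset_compact (f := (K : X →ₗ[ℂ] X)) 3
  obtain ⟨y, -, ψ, hψ, hlim⟩ := hC.tendsto_subseq
    (fun n => hC' ⟨f n, by simpa using hfnorm n, rfl⟩)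
  have hc := hlim.cauchySeq
  rw [Metric.cauchySeq_iff'] at hc
  obtain ⟨n, hn⟩ := hc ‖μ‖ (norm_pos_iff.2 hμ)
  have h1 := hn (n + 1) n.le_succ
  rw [dist_eq_norm] at h1
  exact absurd (hsep _ _ (hψ n.lt_succ_self)) (not_le.2 h1)

theorem finiteDimensional_maxGenEigenspace_of_isCompactOperator [CompleteSpace X] {K : X →L[ℂ] X}
    (hK : IsCompactOperator K) {μ : ℂ} (hμ : μ ≠ 0) :
    FiniteDimensional ℂ (End.maxGenEigenspace (K : End ℂ X) μ) := by
  obtain ⟨p, hp⟩ := exists_ker_pow_eq_of_isCompactOperator hK hμ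
  have := finiteDimensional_ker_pow_of_isCompactOperator hK hμ p
  refine Submodule.finiteDimensional_of_le (S₂ := LinearMap.ker
    (((K : End ℂ X) - μ • (1 : End ℂ X)) ^ p)) fun x hx => ?_
  obtain ⟨k, hk⟩ := (End.mem_maxGenEigenspace _ _ _).1 hx
  rw [End.ker_pow_constant hp k, LinearMap.mem_ker, pow_add, Module.End.mul_apply, hk, map_zero]

theorem maxGenEigenspace_le_maxGenEigenspace_pow (f : End ℂ X) (μ : ℂ) (N : ℕ) :
    End.maxGenEigenspace f μ ≤ End.maxGenEigenspace (f ^ N) (μ ^ N) := by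
  intro x hx
  rw [End.mem_maxGenEigenspace] at hx ⊢
  obtain ⟨k, hk⟩ := hx
  refine ⟨k, ?_⟩
  have hcomm : Commute f (μ • (1 : End ℂ X)) := (Commute.one_right f).smul_right μ
  have h := hcomm.mul_geom_sum₂ N
  rw [_root_.smul_pow, one_pow] at h
  rw [← h]
  have hc2 : Commute (f - μ • (1 : End ℂ X))
      (∑ i ∈ Finset.range N, f ^ i * (μ • (1 : End ℂ X)) ^ (N - 1 - i)) := by
    refine Commute.sum_right _ _ _ fun i _ => ?_
    refine Commute.mul_right (Commute.pow_right ?_ _) (Commute.pow_right ?_ _)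
    · exact (Commute.refl f).sub_left hcomm.symm
    · exact (hcomm).sub_left (Commute.refl _)
  rw [hc2.mul_pow, (hc2.pow_pow k k).eq, Module.End.mul_apply, hk, map_zero]

theorem finiteDimensional_maxGenEigenspace [CompleteSpace X] {T : X →L[ℂ] X} {N : ℕ}
    (hK : IsCompactOperator (T ^ N : X →L[ℂ] X)) {μ : ℂ} (hμ : μ ≠ 0) :
    FiniteDimensional ℂ (End.maxGenEigenspace (T : End ℂ X) μ) := by
  have := finiteDimensional_maxGenEigenspace_of_isCompactOperator hK (pow_ne_zero N hμ)
  rw [ContinuousLinearMap.toLinearMap_pow] at this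
  exact Submodule.finiteDimensional_of_le (maxGenEigenspace_le_maxGenEigenspace_pow _ _ N)

theorem ker_aeval_prod_X_sub_C_pow_le (f : End ℂ X) (t : Finset ℂ) (n : ℕ) :
    LinearMap.ker (aeval f (∏ l ∈ t, (Polynomial.X - C l) ^ n)) ≤
      ⨆ l ∈ t, End.maxGenEigenspace f l := by
  induction t using Finset.induction_on with
  | empty =>
    intro x hx
    simpa using hx
  | insert a t ha ih =>
    rw [Finset.prod_insert ha, ← sup_ker_aeval_eq_ker_aeval_mul_of_coprime, Finset.iSup_insert]
    · refine sup_le_sup (fun x hx => ?_) ih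
      rw [End.mem_maxGenEigenspace]
      refine ⟨n, ?_⟩
      simpa [Algebra.algebraMap_eq_smul_one] using hx
    · refine IsCoprime.prod_right fun l hl => ?_
      refine IsCoprime.pow ?_
      refine isCoprime_X_sub_C_of_isUnit_sub ?_
      refine (sub_ne_zero.2 ?_).isUnit
      rintro rfl
      exact ha hl

theorem exists_iSup_maxGenEigenspace_eq_ker [CompleteSpace X] {T : X →L[ℂ] X} {N : ℕ}
    (hK : IsCompactOperator (T ^ N : X →L[ℂ] X)) (s : Finset ℂ) (hs : (0 : ℂ) ∉ s) :
    ∃ n : ℕ, ⨆ l ∈ s, End.maxGenEigenspace (T : End ℂ X) l ≤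
      LinearMap.ker (aeval (T : End ℂ X) (∏ l ∈ s, (Polynomial.X - C l) ^ n)) := by
  have h1 : ∀ l : ℂ, ∃ p : ℕ, l ∈ s → End.maxGenEigenspace (T : End ℂ X) l ≤
      LinearMap.ker (((T : End ℂ X) - l • (1 : End ℂ X)) ^ p) := by
    intro l
    by_cases hl : l ∈ s
    · have hfd := finiteDimensional_maxGenEigenspace hK (μ := l) (fun h => hs (h ▸ hl))
      have hfg := (Submodule.fg_iff_finiteDimensional _).2 hfd
      obtain ⟨b, hb⟩ := hfg
      have : ∀ x : X, ∃ p, x ∈ b → (((T : End ℂ X) - l • (1 : End ℂ X)) ^ p) x = 0 := by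
        intro x
        by_cases hx : x ∈ b
        · obtain ⟨p, hp⟩ := (End.mem_maxGenEigenspace _ _ _).1
            (hb ▸ Submodule.subset_span (Finset.mem_coe.2 hx) :
              x ∈ End.maxGenEigenspace (T : End ℂ X) l)
          exact ⟨p, fun _ => hp⟩
        · exact ⟨0, fun h => absurd h hx⟩
      choose p hp using this
      refine ⟨b.sup p, fun _ => ?_⟩
      rw [← hb, Submodule.span_le]
      intro x hx
      have hle : p x ≤ b.sup p := Finset.le_sup hx
      obtain ⟨d, hd⟩ := Nat.exists_eq_add_of_le' hle
      change (((T : End ℂ X) - l • (1 : End ℂ X)) ^ (b.sup p)) x = 0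
      rw [hd, pow_add, Module.End.mul_apply, hp x hx, map_zero]
    · exact ⟨0, fun h => absurd h hl⟩
  choose p hp using h1
  refine ⟨s.sup p, iSup₂_le fun l hl x hx => ?_⟩
  have h2 := hp l hl hx
  obtain ⟨d, hd⟩ := Nat.exists_eq_add_of_le' (Finset.le_sup (f := p) hl)
  rw [← Finset.prod_erase_mul _ _ hl, LinearMap.mem_ker, map_mul, Module.End.mul_apply]
  have : aeval (T : End ℂ X) ((Polynomial.X - C l) ^ s.sup p) =
      ((T : End ℂ X) - l • (1 : End ℂ X)) ^ s.sup p := by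
    simp [Algebra.algebraMap_eq_smul_one]
  rw [this, hd, pow_add, Module.End.mul_apply, LinearMap.mem_ker.1 h2, map_zero, map_zero]

end Spectral

section Spectral

open Module Polynomial

variable {X : Type*} [NormedAddCommGroup X] [NormedSpace ℂ X]

theorem exists_eigenvalue_of_aeval_apply_eq_zero (f : End ℂ X) (p : ℂ[X]) (hp : p ≠ 0) (v : X)
    (hv : v ≠ 0) (h : aeval f p v = 0) : ∃ μ ∈ p.roots, f.HasEigenvalue μ := by
  have hsp := (IsAlgClosed.splits p).eq_prod_roots
  have key : ∀ m : Multiset ℂ, ∀ v : X, v ≠ 0 →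
      aeval f (m.map fun a => Polynomial.X - C a).prod v = 0 → ∃ μ ∈ m, f.HasEigenvalue μ := by
    intro m
    induction m using Multiset.induction_on with
    | empty =>
      intro v hv h
      simp only [Multiset.map_zero, Multiset.prod_zero, map_one, End.one_apply] at h
      exact absurd h hv
    | cons a m ih =>
      intro v hv h
      rw [Multiset.map_cons, Multiset.prod_cons, map_mul, Module.End.mul_apply] at h
      by_cases h0 : aeval f (m.map fun a => Polynomial.X - C a).prod v = 0
      · obtain ⟨μ, hμ, h1⟩ := ih v hv h0
        exact ⟨μ, Multiset.mem_cons_of_mem hμ, h1⟩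
      · refine ⟨a, Multiset.mem_cons_self a m, End.hasEigenvalue_of_hasEigenvector
          (x := aeval f (m.map fun a => Polynomial.X - C a).prod v) ⟨?_, h0⟩⟩
        rw [End.mem_eigenspace_iff]
        simpa [sub_eq_zero, Algebra.algebraMap_eq_smul_one] using h
  refine key _ v hv ?_
  rw [hsp, map_mul, Module.End.mul_apply] at h
  have hl : p.leadingCoeff ≠ 0 := leadingCoeff_ne_zero.2 hp
  simpa [hl, Algebra.algebraMap_eq_smul_one] using h

theorem exists_eigenvalue_of_mem_spectrum [CompleteSpace X] {T : X →L[ℂ] X} {N : ℕ} (hN : N ≠ 0)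
    (hK : IsCompactOperator (T ^ N : X →L[ℂ] X)) {μ : ℂ} (hμ : μ ≠ 0) (h : μ ∈ spectrum ℂ T) :
    ∃ ν : ℂ, ‖ν‖ = ‖μ‖ ∧ End.HasEigenvalue (T : End ℂ X) ν := by
  have h1 := spectrum.pow_mem_pow T N h
  rw [← hK.hasEigenvalue_iff_mem_spectrum (pow_ne_zero N hμ)] at h1
  obtain ⟨v, hv⟩ := h1.exists_hasEigenvector
  have hv1 := hv.apply_eq_smul
  have hne : (Polynomial.X ^ N - C (μ ^ N) : ℂ[X]) ≠ 0 := X_pow_sub_C_ne_zero (Nat.pos_of_ne_zero hN) _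
  obtain ⟨ν, hν, h2⟩ := exists_eigenvalue_of_aeval_apply_eq_zero (T : End ℂ X)
    (Polynomial.X ^ N - C (μ ^ N)) hne v hv.2 (by
      rw [ContinuousLinearMap.toLinearMap_pow] at hv1
      simp only [map_sub, map_pow, aeval_X, aeval_C, LinearMap.sub_apply, hv1]
      simp [Algebra.algebraMap_eq_smul_one, _root_.smul_pow])
  refine ⟨ν, ?_, h2⟩
  rw [mem_roots hne] at hν
  have h3 : ν ^ N = μ ^ N := by simpa [sub_eq_zero] using hν
  have h4 := congrArg norm h3
  rw [norm_pow, norm_pow] at h4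
  exact (pow_left_inj₀ (norm_nonneg _) (norm_nonneg _) hN).1 h4
end Spectral

section Spectral

open Module Polynomial

variable {X : Type*} [NormedAddCommGroup X] [NormedSpace ℂ X]

theorem coe_aeval_continuousLinearMap (T : X →L[ℂ] X) (p : ℂ[X]) :
    ((aeval T p : X →L[ℂ] X) : End ℂ X) = aeval (T : End ℂ X) p := by
  induction p using Polynomial.induction_on' with
  | add p q hp hq => rw [map_add, map_add, ← hp, ← hq, ContinuousLinearMap.toLinearMap_add]
  | monomial j a =>
    ext x
    simp [aeval_monomial, Algebra.algebraMap_eq_smul_one]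

theorem exists_norm_pow_le_of_spectrum [CompleteSpace X] [Nontrivial X] (T : X →L[ℂ] X) {ρ : ℝ}
    (hρ : 0 < ρ) (h : ∀ μ ∈ spectrum ℂ T, ‖μ‖ < ρ) : ∃ C : ℝ, ∀ n : ℕ, ‖T ^ n‖ ≤ C * ρ ^ n := by
  obtain ⟨z, hz, hz'⟩ := spectrum.exists_nnnorm_eq_spectralRadius T
  have h1 := spectrum.pow_nnnorm_pow_one_div_tendsto_nhds_spectralRadius T
  have h2 : spectralRadius ℂ T < ENNReal.ofReal ρ := by
    rw [← hz', ← enorm_eq_nnnorm, ← ofReal_norm]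
    exact (ENNReal.ofReal_lt_ofReal_iff hρ).2 (h z hz)
  have h3 := (h1.eventually_lt_const h2).and (Filter.eventually_ge_atTop 1)
  rw [Filter.eventually_atTop] at h3
  obtain ⟨n₀, hn₀⟩ := h3
  refine ⟨1 + ∑ i ∈ Finset.range n₀, ‖T ^ i‖ / ρ ^ i, fun n => ?_⟩
  have hsum : 0 ≤ ∑ i ∈ Finset.range n₀, ‖T ^ i‖ / ρ ^ i :=
    Finset.sum_nonneg fun i _ => by positivity
  rcases lt_or_ge n n₀ with hn | hn
  · have := Finset.single_le_sum (f := fun i => ‖T ^ i‖ / ρ ^ i) (fun i _ => by positivity)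
      (Finset.mem_range.2 hn)
    have h4 : ‖T ^ n‖ / ρ ^ n ≤ 1 + ∑ i ∈ Finset.range n₀, ‖T ^ i‖ / ρ ^ i := by linarith
    rwa [div_le_iff₀ (by positivity)] at h4
  · obtain ⟨h4, h5⟩ := hn₀ n hn
    have hn0 : (0 : ℝ) < n := by exact_mod_cast h5
    have h6 := ENNReal.rpow_le_rpow h4.le hn0.le
    rw [← ENNReal.rpow_mul, one_div_mul_cancel hn0.ne', ENNReal.rpow_one, ENNReal.rpow_natCast,
      ← ENNReal.ofReal_pow hρ.le, ← enorm_eq_nnnorm, ← ofReal_norm] at h6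
    have h7 := (ENNReal.ofReal_le_ofReal_iff (by positivity)).1 h6
    refine h7.trans ?_
    have : 0 < ρ ^ n := by positivity
    nlinarith

theorem exists_mem_iSup_maxGenEigenspace_norm_pow_sub_le [CompleteSpace X] [Nontrivial X]
    {T : X →L[ℂ] X} {N : ℕ} (hN : N ≠ 0) (hK : IsCompactOperator (T ^ N : X →L[ℂ] X)) {ρ : ℝ}
    (hρ : 0 < ρ) (s : Finset ℂ) (hs : ∀ l ∈ s, ρ ≤ ‖l‖)
    (hs' : ∀ μ : ℂ, ρ ≤ ‖μ‖ → End.HasEigenvalue (T : End ℂ X) μ → μ ∈ s) (φ : X) :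
    ∃ e ∈ ⨆ l ∈ s, End.maxGenEigenspace (T : End ℂ X) l, ∃ C : ℝ, ∀ n : ℕ,
      ‖(T ^ n) (φ - e)‖ ≤ C * ρ ^ n := by
  have hs0 : (0 : ℂ) ∉ s := fun h => by
    have := hs 0 h
    rw [norm_zero] at this
    linarith
  obtain ⟨n, hn⟩ := exists_iSup_maxGenEigenspace_eq_ker hK s hs0
  set E := ⨆ l ∈ s, End.maxGenEigenspace (T : End ℂ X) l with hE
  set P : ℂ[X] := ∏ l ∈ s, (Polynomial.X - C l) ^ n with hP
  have hEfd : FiniteDimensional ℂ E := by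
    have : ∀ l : s, FiniteDimensional ℂ (End.maxGenEigenspace (T : End ℂ X) l) := fun l =>
      finiteDimensional_maxGenEigenspace hK fun h => hs0 (h ▸ l.2)
    have h2 : E = ⨆ l : s, End.maxGenEigenspace (T : End ℂ X) l := by
      rw [hE, iSup_subtype']
    rw [h2]
    infer_instance
  have hTE : ∀ x ∈ E, T x ∈ E := by
    have : E ≤ E.comap (T : End ℂ X) := iSup₂_le fun l hl x hx => by
      have h1 : (T : End ℂ X) x ∈ End.maxGenEigenspace (T : End ℂ X) l :=
        End.mapsTo_maxGenEigenspace_of_comm (Commute.refl _) l hx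
      exact Submodule.mem_iSup_of_mem l (Submodule.mem_iSup_of_mem hl h1)
    exact this
  obtain ⟨p, hp⟩ := Submodule.ClosedComplemented.of_finiteDimensional E
  set π : X →L[ℂ] X := E.subtypeL ∘L p with hπ
  have hπE : ∀ x, π x ∈ E := fun x => (p x).2
  have hπid : ∀ x ∈ E, π x = x := fun x hx => congrArg Subtype.val (hp ⟨x, hx⟩)
  set T' : X →L[ℂ] X := T - T ∘L π with hT'
  have hT'T : ∀ x, T' x = T x - T (π x) := fun x => rfl
  have hT'E : ∀ x ∈ E, T' x = 0 := fun x hx => by rw [hT'T, hπid x hx, sub_self]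
  have hmod : ∀ (j : ℕ) (x : X), (T' ^ j) x - (T ^ j) x ∈ E := by
    intro j x
    induction j with
    | zero => simp
    | succ j ih =>
      have h1 : (T' ^ (j + 1)) x - (T ^ (j + 1)) x =
          T ((T' ^ j) x - (T ^ j) x) - T (π ((T' ^ j) x)) := by
        simp only [pow_succ', mul_apply_eq_comp, hT'T, map_sub]
        abel
      rw [h1]
      exact E.sub_mem (hTE _ ih) (hTE _ (hπE _))
  have hmodP : ∀ (q : ℂ[X]) (x : X), (aeval T' q) x - (aeval T q) x ∈ E := by
    intro q x
    induction q using Polynomial.induction_on' with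
    | add q r hq hr =>
      have h1 : (aeval T' (q + r)) x - (aeval T (q + r)) x =
          ((aeval T' q) x - (aeval T q) x) + ((aeval T' r) x - (aeval T r) x) := by
        simp only [map_add, add_apply]
        abel
      rw [h1]
      exact E.add_mem hq hr
    | monomial j a =>
      have h1 : (aeval T' (monomial j a)) x - (aeval T (monomial j a)) x =
          a • ((T' ^ j) x - (T ^ j) x) := by
        simp [aeval_monomial, Algebra.algebraMap_eq_smul_one, smul_sub]
      rw [h1]
      exact E.smul_mem _ (hmod _ _)
  have hK' : IsCompactOperator (T' ^ N : X →L[ℂ] X) := by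
    have h1 : IsCompactOperator (π ∘L (T' ^ N - T ^ N) : X →L[ℂ] X) := by
      have h2 : IsCompactOperator (p : X →L[ℂ] E) := by
        have : ProperSpace E := FiniteDimensional.proper ℂ E
        exact isCompactOperator_of_locallyCompactSpace_dom p
      exact (h2.clm_comp E.subtypeL).comp_clm (T' ^ N - T ^ N)
    have h3 : (T' ^ N : X →L[ℂ] X) = T ^ N + π ∘L (T' ^ N - T ^ N) := by
      ext x
      have := hπid _ (hmod N x)
      simp only [add_apply, ContinuousLinearMap.comp_apply,
        sub_apply, this]
      abel
    rw [h3]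
    exact hK.add h1
  have hspec : ∀ μ ∈ spectrum ℂ T', ‖μ‖ < ρ := by
    intro μ hμ
    by_contra! hle
    have hμ0 : μ ≠ 0 := norm_pos_iff.1 (hρ.trans_le hle)
    obtain ⟨ν, hν, hev⟩ := exists_eigenvalue_of_mem_spectrum hN hK' hμ0 hμ
    obtain ⟨v, hv⟩ := hev.exists_hasEigenvector
    have hv1 : T' v = ν • v := hv.apply_eq_smul
    have hν0 : ν ≠ 0 := norm_pos_iff.1 (by rw [hν]; exact hρ.trans_le hle)
    have hvE : v ∈ E := by
      have h1 : ((T : End ℂ X) - ν • (1 : End ℂ X)) v ∈ E := by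
        have : ((T : End ℂ X) - ν • (1 : End ℂ X)) v = T (π v) := by
          simp [← hv1, hT'T]
        rw [this]
        exact hTE _ (hπE _)
      have h2 : aeval (T : End ℂ X) (P * (Polynomial.X - C ν)) v = 0 := by
        rw [map_mul, Module.End.mul_apply]
        have := LinearMap.mem_ker.1 (hn h1)
        simpa [Algebra.algebraMap_eq_smul_one] using this
      have hdvd : P * (Polynomial.X - C ν) ∣
          ∏ l ∈ insert ν s, (Polynomial.X - C l) ^ (n + 1) := by
        have h3 : P ∣ ∏ l ∈ insert ν s, (Polynomial.X - C l) ^ n :=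
          Finset.prod_dvd_prod_of_subset _ _ _ (Finset.subset_insert _ _)
        have h4 : (Polynomial.X - C ν) ∣ ∏ l ∈ insert ν s, (Polynomial.X - C l) :=
          Finset.dvd_prod_of_mem (fun l => Polynomial.X - C l) (Finset.mem_insert_self ν s)
        simpa only [pow_succ, Finset.prod_mul_distrib] using mul_dvd_mul h3 h4
      obtain ⟨r, hr⟩ := hdvd
      have h5 : v ∈ LinearMap.ker (aeval (T : End ℂ X)
          (∏ l ∈ insert ν s, (Polynomial.X - C l) ^ (n + 1))) := by
        rw [LinearMap.mem_ker, hr, mul_comm, map_mul, Module.End.mul_apply, h2, map_zero]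
      have h6 := ker_aeval_prod_X_sub_C_pow_le _ _ _ h5
      rw [Finset.iSup_insert] at h6
      refine (sup_le ?_ le_rfl : _ ≤ E) h6
      by_cases hνev : End.HasEigenvalue (T : End ℂ X) ν
      · exact le_iSup₂_of_le ν (hs' ν (hν ▸ hle) hνev) le_rfl
      · intro x hx
        obtain ⟨k, hk⟩ := (End.mem_maxGenEigenspace _ _ _).1 hx
        have hx0 : x = 0 := by
          by_contra hx0
          obtain ⟨μ', hμ', hev'⟩ := exists_eigenvalue_of_aeval_apply_eq_zero (T : End ℂ X)
            ((Polynomial.X - C ν) ^ k) (pow_ne_zero _ (X_sub_C_ne_zero ν)) x hx0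
            (by simpa [Algebra.algebraMap_eq_smul_one] using hk)
          rw [roots_pow, roots_X_sub_C] at hμ'
          have := Multiset.mem_of_mem_nsmul hμ'
          rw [Multiset.mem_singleton] at this
          exact hνev (this ▸ hev')
        rw [hx0]
        exact E.zero_mem
    rw [hT'E v hvE] at hv1
    exact (smul_ne_zero hν0 hv.2) hv1.symm
  obtain ⟨C₁, hC₁⟩ := exists_norm_pow_le_of_spectrum T' hρ hspec
  have hunit : IsUnit (aeval T' P) := by
    by_contra hnu
    have h0 : (0 : ℂ) ∈ spectrum ℂ (aeval T' P) := (spectrum.zero_mem_iff ℂ).2 hnu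
    rw [spectrum.map_polynomial_aeval_of_nonempty T' P (spectrum.nonempty T')] at h0
    obtain ⟨k, hk, hk0⟩ := h0
    simp only [hP, eval_prod, eval_pow, eval_sub, eval_X, eval_C, Finset.prod_eq_zero_iff] at hk0
    obtain ⟨l, hl, hl0⟩ := hk0
    have : k = l := sub_eq_zero.1 (eq_zero_of_pow_eq_zero hl0)
    exact absurd (hspec k hk) (not_lt.2 (this ▸ hs l hl))
  obtain ⟨u, hu⟩ := hunit
  set z : X := ((u⁻¹ : (X →L[ℂ] X)ˣ) : X →L[ℂ] X) φ with hz
  have hz' : aeval T' P z = φ := by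
    rw [← hu, hz, ← mul_apply_eq_comp, Units.mul_inv, one_apply_eq_self]
  refine ⟨aeval T' P z - aeval T P z, hmodP P z, ‖aeval T P‖ * C₁ * ‖z‖, fun j => ?_⟩
  have h1 : (T ^ j) (φ - (aeval T' P z - aeval T P z)) = aeval T P ((T' ^ j) z) := by
    rw [hz', sub_sub_cancel]
    have h2 : (T ^ j) (aeval T P z) = aeval T P ((T ^ j) z) := by
      have h3 : aeval T (Polynomial.X ^ j * P) = aeval T (P * Polynomial.X ^ j) := by rw [mul_comm]
      have h4 := congrArg (fun S : X →L[ℂ] X => S z) h3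
      simpa [map_mul] using h4
    rw [h2]
    have h3 := LinearMap.mem_ker.1 (hn (hmod j z))
    rw [← coe_aeval_continuousLinearMap] at h3
    have h4 : aeval T P ((T' ^ j) z - (T ^ j) z) = 0 := h3
    rw [map_sub, sub_eq_zero] at h4
    exact h4.symm
  rw [h1]
  calc ‖aeval T P ((T' ^ j) z)‖ ≤ ‖aeval T P‖ * (‖T' ^ j‖ * ‖z‖) :=
        (ContinuousLinearMap.le_opNorm _ _).trans
          (mul_le_mul_of_nonneg_left (ContinuousLinearMap.le_opNorm _ _) (norm_nonneg _))
    _ ≤ ‖aeval T P‖ * (C₁ * ρ ^ j * ‖z‖) := by gcongr; exact hC₁ j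
    _ = _ := by ring

theorem exists_norm_pow_le_of_mem_maxGenEigenspace (T : X →L[ℂ] X) {l : ℂ} {R : ℝ}
    (hR : ‖l‖ < R) {e : X} (he : e ∈ End.maxGenEigenspace (T : End ℂ X) l) :
    ∃ C : ℝ, ∀ n : ℕ, ‖(T ^ n) e‖ ≤ C * R ^ n := by
  obtain ⟨p, hp⟩ := (End.mem_maxGenEigenspace _ _ _).1 he
  clear he
  have hR0 : 0 < R := (norm_nonneg l).trans_lt hR
  induction p generalizing e with
  | zero =>
    refine ⟨0, fun n => ?_⟩
    have : e = 0 := by simpa using hp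
    simp [this]
  | succ p ih =>
    obtain ⟨C, hC⟩ := ih (e := T e - l • e) (by
      rw [pow_succ, Module.End.mul_apply] at hp
      simpa using hp)
    have hC0 : 0 ≤ C := by simpa using (norm_nonneg _).trans (hC 0)
    refine ⟨‖e‖ + C / (R - ‖l‖), fun n => ?_⟩
    have hd : 0 < R - ‖l‖ := sub_pos.2 hR
    induction n with
    | zero => simp; positivity
    | succ n ihn =>
      have h1 : (T ^ (n + 1)) e = (T ^ n) (T e - l • e) + l • (T ^ n) e := by
        rw [pow_succ, mul_apply_eq_comp, map_sub, map_smul, sub_add_cancel]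
      rw [h1]
      calc ‖(T ^ n) (T e - l • e) + l • (T ^ n) e‖
          ≤ C * R ^ n + ‖l‖ * ((‖e‖ + C / (R - ‖l‖)) * R ^ n) := by
            refine (norm_add_le _ _).trans (add_le_add (hC n) ?_)
            rw [norm_smul]
            gcongr
        _ = (R * (‖e‖ + C / (R - ‖l‖)) - (R - ‖l‖) * ‖e‖) * R ^ n := by
            field_simp
            ring
        _ ≤ (R * (‖e‖ + C / (R - ‖l‖))) * R ^ n := by
            gcongr
            have : 0 ≤ (R - ‖l‖) * ‖e‖ := by positivity
            linarith
        _ = _ := by ring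

end Spectral

section Spectral

open Module Polynomial

variable {X : Type*} [NormedAddCommGroup X] [NormedSpace ℂ X]

theorem AlternatingMap.map_eq_zero_of_smul_eq {ι : Type*} (D : X [⋀^ι]→ₗ[ℂ] ℂ) (v : ι → X)
    {i i' : ι} (hne : i ≠ i') {w : X} {a b : ℂ} (h1 : v i = a • w) (h2 : v i' = b • w) :
    D v = 0 := by
  refine D.map_linearDependent v fun hv => ?_
  have h3 := (hv.comp ![i, i'] (by
    intro x y hxy
    fin_cases x <;> fin_cases y <;> simp_all [hne.symm]))
  have h4 : LinearIndependent ℂ ![v i, v i'] := by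
    have h5 : ![v i, v i'] = v ∘ ![i, i'] := by
      ext x
      fin_cases x <;> rfl
    exact h5 ▸ h3
  rw [LinearIndependent.pair_iff] at h4
  have h5 := (h4 b (-a) (by rw [h1, h2, smul_smul, smul_smul, mul_comm b a, neg_mul, neg_smul,
    add_neg_cancel])).1
  exact hv.ne_zero i' (by rw [h2, h5, zero_smul])

theorem prod_comp_le_prod_Icc {k : ℕ} (r : ℕ → ℝ) {ρ : ℝ} (hρ : 0 < ρ) (h0 : r 0 = ρ)
    (hr : ∀ j ∈ Finset.Icc 1 k, ρ ≤ r j) (p : Fin k → ℕ)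
    (hp : ∀ i, p i ≠ 0 → p i ∈ Finset.Icc 1 k) (hinj : ∀ i i', p i ≠ 0 → p i = p i' → i = i') :
    ∏ i, r (p i) ≤ ∏ j ∈ Finset.Icc 1 k, r j := by
  classical
  set A := Finset.univ.filter fun i => p i ≠ 0 with hA
  have hinjA : Set.InjOn p A := fun i hi i' _ h => hinj i i' (by simpa [hA] using hi) h
  have himg : A.image p ⊆ Finset.Icc 1 k := by
    intro j hj
    obtain ⟨i, hi, rfl⟩ := Finset.mem_image.1 hj
    exact hp i (by simpa [hA] using hi)
  have hcard : (A.image p).card = A.card := Finset.card_image_of_injOn hinjA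
  have h1 : ∏ i, r (p i) = (∏ j ∈ A.image p, r j) * ρ ^ (k - A.card) := by
    rw [← Finset.prod_mul_prod_compl A, Finset.prod_image hinjA]
    congr 1
    rw [Finset.prod_congr rfl (g := fun _ => ρ), Finset.prod_const, Finset.card_compl,
      Fintype.card_fin]
    intro i hi
    have : p i = 0 := by simpa [hA] using hi
    rw [this, h0]
  rw [h1, ← Finset.prod_sdiff himg, mul_comm]
  refine mul_le_mul_of_nonneg_right ?_
    (Finset.prod_nonneg fun j hj => hρ.le.trans (hr j (himg hj)))
  have h2 : (Finset.Icc 1 k \ A.image p).card = k - A.card := by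
    rw [Finset.card_sdiff_of_subset himg, hcard, Nat.card_Icc, Nat.add_sub_cancel]
  rw [← h2, ← Finset.prod_const]
  exact Finset.prod_le_prod (fun _ _ => hρ.le) fun j hj => hr j (Finset.mem_sdiff.1 hj).1

theorem norm_alternatingMap_pow_le [CompleteSpace X] [Nontrivial X]
    {T : X →L[ℂ] X} {N : ℕ} (hN : N ≠ 0) (hK : IsCompactOperator (T ^ N : X →L[ℂ] X))
    (Λ : ℕ → ℂ) (hmono : ∀ j, 1 ≤ j → ‖Λ (j + 1)‖ ≤ ‖Λ j‖)
    (hev : ∀ j, 1 ≤ j → Λ j = 0 ∨ End.HasEigenvalue (T : End ℂ X) (Λ j))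
    (hcard : ∀ μ : ℂ, μ ≠ 0 → End.HasEigenvalue (T : End ℂ X) μ →
      Nat.card {j : ℕ | 1 ≤ j ∧ Λ j = μ} = finrank ℂ (End.maxGenEigenspace (T : End ℂ X) μ))
    {k : ℕ} (hk : 1 ≤ k) {ε : ℝ} (hε : 0 < ε) (D : X [⋀^Fin k]→ₗ[ℂ] ℂ) {K : ℝ}
    (hD : ∀ v, ‖D v‖ ≤ K * ∏ i, ‖v i‖) (φ : Fin k → X) :
    ∃ C : ℝ, ∀ n : ℕ, ‖D fun i => (T ^ n) (φ i)‖ ≤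
      C * (∏ j ∈ Finset.Icc 1 k, (‖Λ j‖ + ε)) ^ n := by
  classical
  have hanti : ∀ i j, 1 ≤ i → i ≤ j → ‖Λ j‖ ≤ ‖Λ i‖ := by
    intro i j hi hij
    induction j, hij using Nat.le_induction with
    | base => exact le_rfl
    | succ j hj ih => exact (hmono j (hi.trans hj)).trans ih
  set ρ := ‖Λ k‖ + ε with hρdef
  have hρ : 0 < ρ := by positivity
  set J := (Finset.Icc 1 k).filter fun j => ρ ≤ ‖Λ j‖ with hJ
  have hmemJ : ∀ j, 1 ≤ j → ρ ≤ ‖Λ j‖ → j ∈ J := by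
    intro j hj hjρ
    refine Finset.mem_filter.2 ⟨Finset.mem_Icc.2 ⟨hj, ?_⟩, hjρ⟩
    by_contra! hlt
    have := hanti k j hk hlt.le
    linarith
  have h0J : (0 : ℕ) ∉ J := by simp [hJ]
  have hbasis : ∀ μ : ℂ, ∃ f : ℕ → X, μ ≠ 0 → End.HasEigenvalue (T : End ℂ X) μ →
      (∀ j, 1 ≤ j → Λ j = μ → f j ∈ End.maxGenEigenspace (T : End ℂ X) μ) ∧
      End.maxGenEigenspace (T : End ℂ X) μ ≤ Submodule.span ℂ (f '' {j : ℕ | 1 ≤ j ∧ Λ j = μ}) ∧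
      ∃ j, 1 ≤ j ∧ Λ j = μ := by
    intro μ
    by_cases h : μ ≠ 0 ∧ End.HasEigenvalue (T : End ℂ X) μ
    · obtain ⟨hμ0, hμ⟩ := h
      have hfd := finiteDimensional_maxGenEigenspace hK hμ0
      have hc := hcard μ hμ0 hμ
      have hpos : 0 < finrank ℂ (End.maxGenEigenspace (T : End ℂ X) μ) := by
        obtain ⟨v, hv⟩ := hμ.exists_hasEigenvector
        have hv' : v ∈ End.maxGenEigenspace (T : End ℂ X) μ := by
          refine (End.mem_maxGenEigenspace _ _ _).2 ⟨1, ?_⟩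
          have := hv.apply_eq_smul
          simp only [pow_one, LinearMap.sub_apply, this]
          simp
        have : Nontrivial (End.maxGenEigenspace (T : End ℂ X) μ) :=
          ⟨⟨v, hv'⟩, 0, fun h => hv.2 (congrArg Subtype.val h)⟩
        exact finrank_pos
      rw [← hc] at hpos
      have hne := (Nat.card_pos_iff.1 hpos).1
      have hfin := (Nat.card_pos_iff.1 hpos).2
      let eqv : {j : ℕ | 1 ≤ j ∧ Λ j = μ} ≃ Fin (finrank ℂ (End.maxGenEigenspace (T : End ℂ X) μ)) :=
        (Finite.equivFin _).trans (finCongr hc)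
      let bs := Module.finBasis ℂ (End.maxGenEigenspace (T : End ℂ X) μ)
      refine ⟨fun j => if h : j ∈ {j : ℕ | 1 ≤ j ∧ Λ j = μ} then (bs (eqv ⟨j, h⟩) : X) else 0,
        fun _ _ => ⟨?_, ?_, ?_⟩⟩
      · intro j hj1 hj2
        have : j ∈ {j : ℕ | 1 ≤ j ∧ Λ j = μ} := ⟨hj1, hj2⟩
        simp only [this, dite_true]
        exact (bs _).2
      · intro x hx
        have h1 := bs.sum_repr ⟨x, hx⟩
        have h2 : _ = x := congrArg Subtype.val h1
        rw [← h2]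
        simp only [AddSubmonoidClass.coe_finsetSum]
        refine Submodule.sum_mem _ fun i _ => ?_
        rw [Submodule.coe_smul]
        refine Submodule.smul_mem _ _ (Submodule.subset_span ?_)
        refine ⟨(eqv.symm i : ℕ), (eqv.symm i).2, ?_⟩
        simp only [(eqv.symm i).2, dite_true, Subtype.coe_eta, Equiv.apply_symm_apply]
      · obtain ⟨j, hj⟩ := hne.some
        exact ⟨j, hj⟩
    · exact ⟨0, fun h1 h2 => absurd ⟨h1, h2⟩ h⟩
  choose f hf using hbasis
  set e : ℕ → X := fun j => f (Λ j) j with he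
  have hJev : ∀ j ∈ J, Λ j ≠ 0 ∧ End.HasEigenvalue (T : End ℂ X) (Λ j) := by
    intro j hj
    obtain ⟨h1, h2⟩ := Finset.mem_filter.1 hj
    have h3 : Λ j ≠ 0 := norm_pos_iff.1 (hρ.trans_le h2)
    exact ⟨h3, (hev j (Finset.mem_Icc.1 h1).1).resolve_left h3⟩
  have heJ : ∀ j ∈ J, e j ∈ End.maxGenEigenspace (T : End ℂ X) (Λ j) := by
    intro j hj
    obtain ⟨h1, h2⟩ := hJev j hj
    exact (hf (Λ j) h1 h2).1 j (Finset.mem_Icc.1 (Finset.mem_filter.1 hj).1).1 rfl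
  have hspan : ⨆ l ∈ J.image Λ, End.maxGenEigenspace (T : End ℂ X) l ≤
      Submodule.span ℂ (e '' (J : Set ℕ)) := by
    refine iSup₂_le fun l hl => ?_
    obtain ⟨j, hj, rfl⟩ := Finset.mem_image.1 hl
    obtain ⟨h1, h2⟩ := hJev j hj
    refine (hf (Λ j) h1 h2).2.1.trans (Submodule.span_mono ?_)
    rintro _ ⟨i, ⟨hi1, hi2⟩, rfl⟩
    refine ⟨i, hmemJ i hi1 (hi2 ▸ (Finset.mem_filter.1 hj).2), ?_⟩
    simp only [he, hi2]
  have hdec : ∀ i, ∃ (c : ℕ → ℂ) (y : X) (C : ℝ), φ i = y + ∑ j ∈ J, c j • e j ∧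
      ∀ n : ℕ, ‖(T ^ n) y‖ ≤ C * ρ ^ n := by
    intro i
    obtain ⟨x, hx, C, hC⟩ := exists_mem_iSup_maxGenEigenspace_norm_pow_sub_le hN hK hρ
      (J.image Λ) (fun l hl => by
        obtain ⟨j, hj, rfl⟩ := Finset.mem_image.1 hl
        exact (Finset.mem_filter.1 hj).2)
      (fun μ hμ hμev => by
        obtain ⟨j, hj1, hj2⟩ := (hf μ (norm_pos_iff.1 (hρ.trans_le hμ)) hμev).2.2
        exact Finset.mem_image.2 ⟨j, hmemJ j hj1 (hj2 ▸ hμ), hj2⟩) (φ i)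
    obtain ⟨c, hc⟩ := (Submodule.mem_span_image_finset_iff_exists_fun' ℂ).1 (hspan hx)
    exact ⟨c, φ i - x, C, by rw [hc, sub_add_cancel], hC⟩
  choose c y C₀ hφ hy using hdec
  set r : ℕ → ℝ := fun j => if j = 0 then ρ else ‖Λ j‖ + ε with hr
  set g : Fin k → ℕ → X := fun i j => if j = 0 then y i else c i j • e j with hg
  have hφg : ∀ i, φ i = ∑ j ∈ insert 0 J, g i j := by
    intro i
    rw [Finset.sum_insert h0J, hφ i]
    congr 1
    refine Finset.sum_congr rfl fun j hj => ?_
    have : j ≠ 0 := fun h => h0J (h ▸ hj)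
    simp [hg, this]
  have hbound : ∀ i j, ∃ C : ℝ, j ∈ insert 0 J → ∀ n : ℕ, ‖(T ^ n) (g i j)‖ ≤ C * r j ^ n := by
    intro i j
    by_cases hj0 : j = 0
    · exact ⟨C₀ i, fun _ n => by simpa [hg, hr, hj0] using hy i n⟩
    · by_cases hj : j ∈ J
      · obtain ⟨C, hC⟩ := exists_norm_pow_le_of_mem_maxGenEigenspace T
          (R := ‖Λ j‖ + ε) (by linarith) (heJ j hj)
        refine ⟨‖c i j‖ * C, fun _ n => ?_⟩
        simp only [hg, hr, hj0, if_false, map_smul, norm_smul, mul_assoc]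
        exact mul_le_mul_of_nonneg_left (hC n) (norm_nonneg _)
      · exact ⟨0, fun h => absurd ((Finset.mem_insert.1 h).resolve_left hj0) hj⟩
  choose C hC using hbound
  have hK0 : 0 ≤ |K| := abs_nonneg K
  refine ⟨∑ p ∈ Fintype.piFinset fun _ : Fin k => insert 0 J, |K| * ∏ i, C i (p i), fun n => ?_⟩
  have hexp : (D fun i => (T ^ n) (φ i)) =
      ∑ p ∈ Fintype.piFinset fun _ : Fin k => insert 0 J, D fun i => (T ^ n) (g i (p i)) := by
    have := D.toMultilinearMap.map_sum_finset (fun i j => (T ^ n) (g i j)) fun _ => insert 0 J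
    simp only [AlternatingMap.coe_multilinearMap] at this
    rw [← this]
    congr 1
    ext i
    rw [hφg i, map_sum]
  rw [hexp, Finset.sum_mul]
  refine (norm_sum_le _ _).trans (Finset.sum_le_sum fun p hp => ?_)
  rw [Fintype.mem_piFinset] at hp
  have hrn : ∀ i, 0 ≤ r (p i) := by
    intro i
    simp only [hr]
    split_ifs <;> positivity
  have hCn : ∀ i, 0 ≤ C i (p i) := fun i => by
    simpa using (norm_nonneg _).trans (hC i (p i) (hp i) 0)
  by_cases hinj : ∀ i i', p i ≠ 0 → p i = p i' → i = i'
  · have h1 : ∏ i, r (p i) ≤ ∏ j ∈ Finset.Icc 1 k, (‖Λ j‖ + ε) := by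
      refine (prod_comp_le_prod_Icc r hρ (by simp [hr]) ?_ p ?_ hinj).trans_eq ?_
      · intro j hj
        have hj' := Finset.mem_Icc.1 hj
        have hj0 : j ≠ 0 := by omega
        simp only [hr, hj0, if_false, hρdef]
        have := hanti j k hj'.1 hj'.2
        linarith
      · intro i hi
        exact (Finset.mem_filter.1 ((Finset.mem_insert.1 (hp i)).resolve_left hi)).1
      · refine Finset.prod_congr rfl fun j hj => ?_
        have hj0 : j ≠ 0 := by have := (Finset.mem_Icc.1 hj).1; omega
        simp [hr, hj0]
    calc ‖D fun i => (T ^ n) (g i (p i))‖ ≤ K * ∏ i, ‖(T ^ n) (g i (p i))‖ := hD _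
      _ ≤ |K| * ∏ i, ‖(T ^ n) (g i (p i))‖ :=
          mul_le_mul_of_nonneg_right (le_abs_self K) (Finset.prod_nonneg fun _ _ => norm_nonneg _)
      _ ≤ |K| * ∏ i, (C i (p i) * r (p i) ^ n) := by
          refine mul_le_mul_of_nonneg_left ?_ hK0
          exact Finset.prod_le_prod (fun _ _ => norm_nonneg _) fun i _ => hC i _ (hp i) n
      _ = |K| * (∏ i, C i (p i)) * (∏ i, r (p i)) ^ n := by
          rw [Finset.prod_mul_distrib, Finset.prod_pow, mul_assoc]
      _ ≤ _ := by
          refine mul_le_mul_of_nonneg_left ?_ (mul_nonneg hK0 (Finset.prod_nonneg fun i _ => hCn i))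
          exact pow_le_pow_left₀ (Finset.prod_nonneg fun i _ => hrn i) h1 n
  · push Not at hinj
    obtain ⟨i, i', hi0, hii, hne⟩ := hinj
    have hz : (D fun i => (T ^ n) (g i (p i))) = 0 := by
      refine D.map_eq_zero_of_smul_eq _ hne (w := (T ^ n) (e (p i))) (a := c i (p i))
        (b := c i' (p i)) ?_ ?_
      · simp [hg, hi0]
      · have : p i' ≠ 0 := hii ▸ hi0
        simp only [hg, ← hii, hi0, if_false, map_smul]
    rw [hz, norm_zero]
    exact mul_nonneg (mul_nonneg hK0 (Finset.prod_nonneg fun i _ => hCn i))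
      (pow_nonneg (Finset.prod_nonneg fun _ _ => by positivity) n)

end Spectral

section Determinants

/-- The determinant of the functions `f i` sampled at the points `s j`. -/
def sampleDet {𝕜 : Type*} [CommRing 𝕜] {n : ℕ} (f : Fin n → ℝ → 𝕜) (s : Fin n → ℝ) : 𝕜 :=
  (Matrix.of fun i j => f i (s j)).det

/-- A continuous function on `ℝ` solving `y'(t) = -b(t) y(t-1)` for `t ≥ 0`. -/
def IsDelaySolution {E : Type*} [NormedAddCommGroup E] [NormedSpace ℝ E] (b : ℝ → ℝ) (y : ℝ → E) :
    Prop :=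
  Continuous y ∧ ∀ t₀ t, 0 ≤ t₀ → t₀ ≤ t → y t = y t₀ - ∫ u in t₀..t, b u • y (u - 1)

theorem sampleDet_cons {𝕜 : Type*} [CommRing 𝕜] {n : ℕ} (f : Fin (n + 1) → ℝ → 𝕜)
    (s : Fin n → ℝ) (t : ℝ) :
    sampleDet f (Fin.cons t s : Fin (n + 1) → ℝ) =
      ∑ i : Fin (n + 1), (-1) ^ (i : ℕ) * f i t * sampleDet (fun r => f (i.succAbove r)) s := by
  rw [sampleDet, Matrix.det_succ_column_zero]
  refine Finset.sum_congr rfl fun i _ => ?_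
  congr 1

theorem sampleDet_snoc {𝕜 : Type*} [CommRing 𝕜] {n : ℕ} (f : Fin (n + 1) → ℝ → 𝕜)
    (s : Fin n → ℝ) (t : ℝ) :
    sampleDet f (Fin.snoc s t : Fin (n + 1) → ℝ) =
      (-1) ^ n * sampleDet f (Fin.cons t s : Fin (n + 1) → ℝ) := by
  rw [sampleDet_cons, sampleDet, Matrix.det_succ_column _ (Fin.last n), Finset.mul_sum]
  refine Finset.sum_congr rfl fun i _ => ?_
  have h : (Matrix.of fun i j => f i ((Fin.snoc s t : Fin (n + 1) → ℝ) j)).submatrix i.succAbove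
      (Fin.last n).succAbove = Matrix.of fun r j => f (i.succAbove r) (s j) := by
    ext r j
    simp
  rw [h, sampleDet]
  simp only [Fin.val_last, Matrix.of_apply, Fin.snoc_last]
  ring

theorem sampleDet_eq_zero {𝕜 : Type*} [CommRing 𝕜] {n : ℕ} (f : Fin n → ℝ → 𝕜) (s : Fin n → ℝ)
    {i j : Fin n} (hij : i ≠ j) (h : s i = s j) : sampleDet f s = 0 :=
  Matrix.det_zero_of_column_eq hij fun r => by simp [h]

theorem continuous_sampleDet {𝕜 : Type*} [RCLike 𝕜] {n : ℕ} {f : Fin n → ℝ → 𝕜}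
    (hf : ∀ i, Continuous (f i)) : Continuous (sampleDet f) :=
  Continuous.matrix_det (continuous_matrix fun i j => (hf i).comp (continuous_apply j))

theorem sampleDet_snoc_eq_add_integral {𝕜 : Type*} [RCLike 𝕜] {n : ℕ} {f : Fin (n + 1) → ℝ → 𝕜}
    {b : ℝ → ℝ} (hb : LocallyIntegrable b) (hf : ∀ i, IsDelaySolution b (f i)) (s : Fin n → ℝ)
    {t₀ t : ℝ} (h0 : 0 ≤ t₀) (ht : t₀ ≤ t) :
    sampleDet f (Fin.snoc s t : Fin (n + 1) → ℝ) = sampleDet f (Fin.snoc s t₀ : Fin (n + 1) → ℝ) +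
      ∫ u in t₀..t, ((-1) ^ (n + 1) * b u) •
        sampleDet f (Fin.cons (u - 1) s : Fin (n + 1) → ℝ) := by
  simp only [sampleDet_snoc, sampleDet_cons]
  have hbint : ∀ i, IntervalIntegrable (fun u => b u • f i (u - 1)) volume t₀ t := fun i =>
    ((LocallyIntegrable.integrableOn_isCompact hb isCompact_uIcc).intervalIntegrable).smul_continuousOn
      (((hf i).1.comp (continuous_id.sub continuous_const)).continuousOn)
  have h1 : ∀ u, ((-1 : ℝ) ^ (n + 1) * b u) •
      ∑ i : Fin (n + 1), (-1 : 𝕜) ^ (i : ℕ) * f i (u - 1) * sampleDet (fun r => f (i.succAbove r)) s =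
      ∑ i : Fin (n + 1), (-((-1 : 𝕜) ^ n * (-1) ^ (i : ℕ) * sampleDet (fun r => f (i.succAbove r)) s)) *
        (b u • f i (u - 1)) := by
    intro u
    rw [Finset.smul_sum]
    refine Finset.sum_congr rfl fun i _ => ?_
    simp only [RCLike.real_smul_eq_coe_mul, map_mul, map_pow, map_neg, map_one]
    ring
  simp only [h1]
  rw [intervalIntegral.integral_finsetSum fun i _ => (hbint i).const_mul _, Finset.mul_sum,
    Finset.mul_sum, ← Finset.sum_add_distrib]
  refine Finset.sum_congr rfl fun i _ => ?_
  rw [intervalIntegral.integral_const_mul, (hf i).2 t₀ t h0 ht]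
  ring

theorem norm_sampleDet_le_sampleDet {n : ℕ} {f : Fin (n + 1) → ℝ → ℂ} {g : Fin (n + 1) → ℝ → ℝ}
    {b₀ : ℝ} {b : ℝ → ℝ} (hb : LocallyIntegrable b) (hf : ∀ i, IsDelaySolution (fun _ => b₀) (f i))
    (hg : ∀ i, IsDelaySolution b (g i)) (hb₀ : 0 ≤ (-1) ^ (n + 1) * b₀)
    (hbb : ∀ᵐ u, (-1) ^ (n + 1) * b₀ ≤ (-1) ^ (n + 1) * b u)
    (hinit : ∀ s : Fin (n + 1) → ℝ, Monotone s → (∀ i, s i ∈ Set.Icc (-1 : ℝ) 0) →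
      ‖sampleDet f s‖ ≤ sampleDet g s)
    (s : Fin (n + 1) → ℝ) (hs : Monotone s) (h0 : -1 ≤ s 0) (h1 : s (Fin.last n) ≤ s 0 + 1) :
    ‖sampleDet f s‖ ≤ sampleDet g s := by
  have key : ∀ N : ℕ, ∀ s : Fin (n + 1) → ℝ, Monotone s → -1 ≤ s 0 → s (Fin.last n) ≤ s 0 + 1 →
      ∑ i, s i ≤ N - (n + 2) → ‖sampleDet f s‖ ≤ sampleDet g s := by
    intro N
    induction N with
    | zero =>
      intro s hs h0 _ hsum
      have h2 : ∑ _i : Fin (n + 1), (-1 : ℝ) ≤ ∑ i, s i :=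
        Finset.sum_le_sum fun i _ => h0.trans (hs (Fin.zero_le i))
      simp at h2 hsum
      linarith
    | succ N ih =>
      intro s hs h0 h1 hsum
      rcases le_or_gt (s (Fin.last n)) 0 with hl | hl
      · exact hinit s hs fun i => ⟨h0.trans (hs (Fin.zero_le i)), (hs (Fin.le_last i)).trans hl⟩
      obtain ⟨s', t, rfl⟩ : ∃ (s' : Fin n → ℝ) (t : ℝ), s = (Fin.snoc s' t : Fin (n + 1) → ℝ) :=
        ⟨Fin.init s, s (Fin.last n), (Fin.snoc_init_self s).symm⟩
      rw [Fin.snoc_last] at hl h1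
      have hs't : ∀ i, s' i ≤ t := fun i => by
        simpa using hs (Fin.le_last (Fin.castSucc i))
      have hs'm : Monotone s' := fun i j hij => by
        simpa using hs (Fin.castSucc_le_castSucc_iff.2 hij)
      have hs'0 : ∀ i, -1 ≤ s' i := fun i => by
        simpa using h0.trans (hs (Fin.zero_le (Fin.castSucc i)))
      have hs'1 : ∀ i, t ≤ s' i + 1 := fun i => by
        have := hs (Fin.zero_le (Fin.castSucc i))
        rw [Fin.snoc_castSucc] at this
        linarith
      obtain ⟨t₀, ht₀0, ht₀t, ht₀s, hbase⟩ : ∃ t₀, 0 ≤ t₀ ∧ t₀ ≤ t ∧ (∀ i, s' i ≤ t₀) ∧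
          ‖sampleDet f (Fin.snoc s' t₀ : Fin (n + 1) → ℝ)‖ ≤
            sampleDet g (Fin.snoc s' t₀ : Fin (n + 1) → ℝ) := by
        by_cases h : ∀ i, s' i ≤ 0
        · refine ⟨0, le_rfl, hl.le, h, hinit _ ?_ ?_⟩
          · intro i j hij
            induction j using Fin.lastCases with
            | last =>
              rw [Fin.snoc_last]
              induction i using Fin.lastCases with
              | last => simp
              | cast i => simpa using h i
            | cast j =>
              induction i using Fin.lastCases with
              | last => exact absurd hij (not_le.2 (Fin.castSucc_lt_last j))
              | cast i => simpa using hs'm (Fin.castSucc_le_castSucc_iff.1 hij)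
          · intro i
            induction i using Fin.lastCases with
            | last => simp
            | cast i => simpa using ⟨hs'0 i, h i⟩
        · push Not at h
          obtain ⟨i₀, hi₀⟩ := h
          have hn : n ≠ 0 := by rintro rfl; exact i₀.elim0
          obtain ⟨m, rfl⟩ := Nat.exists_eq_succ_of_ne_zero hn
          refine ⟨s' (Fin.last m), hi₀.le.trans (hs'm (Fin.le_last i₀)), hs't _,
            fun i => hs'm (Fin.le_last i), ?_⟩
          have hne : Fin.castSucc (Fin.last m) ≠ Fin.last (m + 1) :=
            (Fin.castSucc_lt_last _).ne
          rw [sampleDet_eq_zero f _ hne (by simp), sampleDet_eq_zero g _ hne (by simp), norm_zero]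
      have hstep : ∀ u ∈ Set.Icc t₀ t,
          ‖sampleDet f (Fin.cons (u - 1) s' : Fin (n + 1) → ℝ)‖ ≤
            sampleDet g (Fin.cons (u - 1) s' : Fin (n + 1) → ℝ) := by
        intro u hu
        refine ih _ ?_ ?_ ?_ ?_
        · intro i j hij
          induction i using Fin.cases with
          | zero =>
            induction j using Fin.cases with
            | zero => exact le_rfl
            | succ j =>
              rw [Fin.cons_zero, Fin.cons_succ]
              linarith [hs'1 j, hu.2]
          | succ i =>
            induction j using Fin.cases with
            | zero => exact absurd hij (not_le.2 (Fin.succ_pos i))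
            | succ j => simpa using hs'm (Fin.succ_le_succ_iff.1 hij)
        · rw [Fin.cons_zero]
          linarith [hu.1]
        · rw [Fin.cons_zero, sub_add_cancel]
          generalize Fin.last n = l
          induction l using Fin.cases with
          | zero =>
            rw [Fin.cons_zero]
            linarith
          | succ i =>
            rw [Fin.cons_succ]
            exact (ht₀s i).trans hu.1
        · rw [Fin.sum_univ_succ]
          rw [Fin.sum_univ_castSucc] at hsum
          simp only [Fin.snoc_castSucc, Fin.snoc_last, Nat.cast_succ] at hsum
          simp only [Fin.cons_zero, Fin.cons_succ]
          linarith [hu.2]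
      rw [sampleDet_snoc_eq_add_integral (locallyIntegrable_const b₀) hf s' ht₀0 ht₀t,
        sampleDet_snoc_eq_add_integral hb hg s' ht₀0 ht₀t]
      refine (norm_add_le _ _).trans (add_le_add hbase ?_)
      have hcc : Continuous fun u : ℝ => (Fin.cons (u - 1) s' : Fin (n + 1) → ℝ) := by
        refine continuous_pi fun i => ?_
        induction i using Fin.cases with
        | zero => simpa using continuous_sub_right (1 : ℝ)
        | succ i => simpa using continuous_const
      refine intervalIntegral.norm_integral_le_of_norm_le ht₀t ?_ ?_
      · filter_upwards [hbb] with u hu hut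
        have h2 := hstep u ⟨hut.1.le, hut.2⟩
        rw [norm_smul, Real.norm_of_nonneg hb₀, smul_eq_mul]
        exact mul_le_mul hu h2 (norm_nonneg _) (hb₀.trans hu)
      · exact (((LocallyIntegrable.integrableOn_isCompact hb isCompact_uIcc).intervalIntegrable).const_mul _).smul_continuousOn
          (((continuous_sampleDet fun i => (hg i).1).comp hcc).continuousOn)
  obtain ⟨N, hN⟩ := exists_nat_ge (∑ i, s i + (n + 2))
  exact key N s hs h0 h1 (by linarith)

end Determinants

section Vandermonde

theorem differentiable_dslope {f : ℂ → ℂ} (hf : Differentiable ℂ f) (a : ℂ) :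
    Differentiable ℂ (dslope f a) := by
  rw [← differentiableOn_univ] at hf ⊢
  exact (Complex.differentiableOn_dslope Filter.univ_mem).2 hf

theorem norm_dslope_le {f : ℂ → ℂ} (hf : Differentiable ℂ f) {K : ℝ}
    (hK : ∀ z, ‖z‖ ≤ 2 → ‖f z‖ ≤ K) {a : ℂ} (ha : ‖a‖ ≤ 1) {z : ℂ} (hz : ‖z‖ ≤ 2) :
    ‖dslope f a z‖ ≤ 2 * K := by
  refine Complex.norm_le_of_forall_mem_frontier_norm_le (U := Metric.ball 0 2)
    Metric.isBounded_ball (differentiable_dslope hf a).diffContOnCl ?_ ?_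
  · intro w hw
    rw [frontier_ball _ two_ne_zero, mem_sphere_zero_iff_norm] at hw
    have h1 : 1 ≤ ‖w - a‖ := by
      have := norm_sub_norm_le w a
      linarith
    have hne : w ≠ a := fun h => by
      rw [h, sub_self, norm_zero] at h1
      linarith
    rw [dslope_of_ne _ hne, slope_def_field, norm_div, div_le_iff₀ (by linarith)]
    have h2 := norm_sub_le (f w) (f a)
    have h3 := hK w hw.le
    have h4 := hK a (by linarith)
    have h5 : 0 ≤ K := (norm_nonneg _).trans h3
    nlinarith
  · rw [closure_ball _ two_ne_zero]
    simpa using hz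

theorem exists_norm_sampleDet_le (n : ℕ) (K : ℝ) : ∃ C : ℝ, 0 ≤ C ∧ ∀ f : Fin n → ℂ → ℂ,
    (∀ i, Differentiable ℂ (f i)) → (∀ i z, ‖z‖ ≤ 2 → ‖f i z‖ ≤ K) → ∀ s : Fin n → ℝ,
    (∀ i, s i ∈ Set.Icc (-1 : ℝ) 0) →
    ‖sampleDet (fun i t => f i (t : ℝ)) s‖ ≤ C * ∏ i, ∏ j ∈ Finset.Ioi i, |s j - s i| := by
  induction n generalizing K with
  | zero => exact ⟨1, zero_le_one, fun f _ _ s _ => by simp [sampleDet]⟩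
  | succ n ih =>
    obtain ⟨C, hC0, hC⟩ := ih (2 * K)
    refine ⟨(n + 1) * |K| * C, by positivity, fun f hf hK s hs => ?_⟩
    set a : ℝ := s 0 with ha
    have hs1 : ∀ i, ‖((s i : ℝ) : ℂ)‖ ≤ 1 := fun i => by
      rw [Complex.norm_real, Real.norm_eq_abs, abs_le]
      exact ⟨(hs i).1, (hs i).2.trans zero_le_one⟩
    set g : Fin (n + 1) → ℂ → ℂ := fun i => dslope (f i) a with hg
    have hdet : sampleDet (fun i t => f i (t : ℝ)) s =
        (Matrix.of fun i (j : Fin (n + 1)) => (Fin.cons (f i a) (fun r : Fin n =>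
          ((s r.succ : ℂ) - a) * g i (s r.succ)) : Fin (n + 1) → ℂ) j).det := by
      rw [sampleDet, ← Matrix.det_transpose, ← Matrix.det_transpose (Matrix.of _)]
      refine Matrix.det_eq_of_forall_row_eq_smul_add_const (Fin.cons 0 fun _ => 1) 0
        (by simp) fun j i => ?_
      induction j using Fin.cases with
      | zero => simp [ha]
      | succ j =>
        have := sub_smul_dslope (f i) (a : ℂ) (s j.succ : ℂ)
        simp only [smul_eq_mul] at this
        simp [hg, this]
    have hminor : ∀ i : Fin (n + 1), ((Matrix.of fun i (j : Fin (n + 1)) => (Fin.cons (f i a)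
        (fun r : Fin n => ((s r.succ : ℂ) - a) * g i (s r.succ)) : Fin (n + 1) → ℂ) j).submatrix
          i.succAbove Fin.succ).det = (∏ j : Fin n, ((s j.succ : ℂ) - a)) *
        sampleDet (fun r t => g (i.succAbove r) (t : ℝ)) fun j => s j.succ := by
      intro i
      rw [sampleDet, ← Matrix.det_mul_row]
      rfl
    rw [hdet, Matrix.det_succ_column_zero]
    simp only [hminor]
    have hterm : ∀ i : Fin (n + 1), ‖sampleDet (fun r t => g (i.succAbove r) (t : ℝ))
        fun j => s j.succ‖ ≤ C * ∏ i : Fin n, ∏ j ∈ Finset.Ioi i, |s j.succ - s i.succ| :=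
      fun i => hC _ (fun r => differentiable_dslope (hf _) _)
        (fun r z hz => norm_dslope_le (hf _) (hK _) (hs1 0) hz) _ fun j => hs _
    rw [Fin.prod_univ_succ]
    simp only [Fin.prod_Ioi_zero, Fin.prod_Ioi_succ]
    refine (norm_sum_le _ _).trans ?_
    have hp : ‖∏ j : Fin n, ((s j.succ : ℂ) - a)‖ = ∏ j : Fin n, |s j.succ - s 0| := by
      rw [norm_prod]
      refine Finset.prod_congr rfl fun j _ => ?_
      rw [← Complex.ofReal_sub, Complex.norm_real, Real.norm_eq_abs]
    refine (Finset.sum_le_card_nsmul _ _ (|K| * ((∏ j : Fin n, |s j.succ - s 0|) *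
      (C * ∏ i : Fin n, ∏ j ∈ Finset.Ioi i, |s j.succ - s i.succ|))) fun i _ => ?_).trans_eq ?_
    · rw [norm_mul, norm_mul, norm_mul, norm_pow, norm_neg, norm_one, one_pow, one_mul, hp]
      have h1 : ‖f i a‖ ≤ |K| := (hK i a ((hs1 0).trans one_le_two)).trans (le_abs_self K)
      refine mul_le_mul h1 ?_ (by positivity) (abs_nonneg K)
      exact mul_le_mul_of_nonneg_left (hterm i) (Finset.prod_nonneg fun _ _ => abs_nonneg _)
    · simp only [Finset.card_univ, Fintype.card_fin, nsmul_eq_mul]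
      push_cast
      ring

end Vandermonde

section Exponentials

/-- The functions `w ↦ exp (z i * w)`, with an extra factor `w` if `z i` has occurred before. -/
def confluentExp {n : ℕ} (z : Fin n → ℂ) (i : Fin n) (w : ℂ) : ℂ :=
  open Classical in
  if ∃ i' < i, z i' = z i then w * Complex.exp (z i * w) else Complex.exp (z i * w)

variable {n : ℕ} {z : Fin n → ℂ}

theorem confluentExp_of_exists {i i' : Fin n} (h : i' < i) (h' : z i' = z i) (w : ℂ) :
    confluentExp z i w = w * Complex.exp (z i * w) :=
  if_pos ⟨i', h, h'⟩

theorem confluentExp_of_forall {i : Fin n} (h : ∀ i' < i, z i' ≠ z i) (w : ℂ) :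
    confluentExp z i w = Complex.exp (z i * w) :=
  if_neg fun ⟨i', h1, h2⟩ => h i' h1 h2

theorem differentiable_confluentExp (i : Fin n) : Differentiable ℂ (confluentExp z i) := by
  have h : Differentiable ℂ fun w : ℂ => Complex.exp (z i * w) := by fun_prop
  by_cases hi : ∃ i' < i, z i' = z i
  · obtain ⟨i', h1, h2⟩ := hi
    rw [funext fun w => confluentExp_of_exists h1 h2 w]
    exact differentiable_id.mul h
  · push Not at hi
    rw [funext fun w => confluentExp_of_forall hi w]
    exact h

theorem sampleDet_confluentExp_add (hz : ∀ i i' i'', i < i' → i' < i'' → z i = z i' → z i' ≠ z i'')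
    (s : Fin n → ℝ) (t : ℝ) :
    sampleDet (fun i (u : ℝ) => confluentExp z i u) (fun j => s j + t) =
      Complex.exp (t * ∑ i, z i) * sampleDet (fun i (u : ℝ) => confluentExp z i u) s := by
  classical
  set U : Matrix (Fin n) (Fin n) ℂ := Matrix.of fun i i' =>
    if i' = i then Complex.exp (t * z i)
    else if i' < i ∧ z i' = z i then t * Complex.exp (t * z i) else 0 with hU
  have hUdet : U.det = Complex.exp (t * ∑ i, z i) := by
    rw [Matrix.det_of_isLowerTriangular]
    · simp [hU, Finset.mul_sum, Complex.exp_sum]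
    · intro i j hij
      have hij' : i < j := hij
      simp [hU, hij'.ne', hij'.not_gt]
  rw [← hUdet, sampleDet, sampleDet, ← Matrix.det_mul]
  congr 1
  ext i j
  simp only [Matrix.of_apply, Matrix.mul_apply]
  have hexp : Complex.exp (z i * ((s j + t : ℝ) : ℂ)) =
      Complex.exp (t * z i) * Complex.exp (z i * s j) := by
    rw [← Complex.exp_add]
    congr 1
    push_cast
    ring
  by_cases hi : ∃ i' < i, z i' = z i
  · obtain ⟨i', h1, h2⟩ := hi
    have hpart : ∀ l < i, z l = z i → l = i' := by
      intro l hl hl'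
      rcases lt_trichotomy l i' with h | h | h
      · exact absurd h2 (hz l i' i h h1 (hl'.trans h2.symm))
      · exact h
      · exact absurd hl' (hz i' l i h hl (h2.trans hl'.symm))
    have hfirst : ∀ l < i', z l ≠ z i' := fun l hl hl' => hz l i' i hl h1 hl' h2
    rw [Finset.sum_eq_add_of_mem i i' (Finset.mem_univ _) (Finset.mem_univ _) h1.ne']
    · rw [confluentExp_of_exists h1 h2, confluentExp_of_exists h1 h2,
        confluentExp_of_forall hfirst, hexp]
      simp only [hU, Matrix.of_apply, if_true, h1.ne, if_false, h1, h2, and_self]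
      push_cast
      ring
    · intro l _ hl
      have : ¬ (l < i ∧ z l = z i) := fun h => hl.2 (hpart l h.1 h.2)
      simp [hU, hl.1, this]
  · push Not at hi
    rw [Finset.sum_eq_single i]
    · rw [confluentExp_of_forall hi, confluentExp_of_forall hi, hexp]
      simp [hU]
    · intro l _ hl
      have : ¬ (l < i ∧ z l = z i) := fun h => hi l h.1 h.2
      simp [hU, hl, this]
    · simp

theorem sampleDet_confluentExp_ne_zero
    (hz : ∀ i i' i'', i < i' → i' < i'' → z i = z i' → z i' ≠ z i'') {h : ℝ} (h0 : h ≠ 0)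
    (hh : ∀ i i', |h * (z i - z i').im| < 2 * Real.pi) :
    sampleDet (fun i (u : ℝ) => confluentExp z i u) (fun j => (j : ℕ) * h) ≠ 0 := by
  classical
  intro hdet
  rw [sampleDet, ← Matrix.exists_mulVec_eq_zero_iff] at hdet
  obtain ⟨a, ha0, ha⟩ := hdet
  have hrow : ∀ i, ∑ j : Fin n, confluentExp z i (((j : ℕ) * h : ℝ) : ℂ) * a j = 0 := fun i =>
    congrFun ha i
  set w : Fin n → ℂ := fun i => Complex.exp (z i * h) with hw
  have hw0 : ∀ i, w i ≠ 0 := fun i => Complex.exp_ne_zero _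
  have hexp : ∀ (i : Fin n) (j : ℕ), Complex.exp (z i * (((j : ℕ) * h : ℝ) : ℂ)) = w i ^ j := by
    intro i j
    rw [hw, ← Complex.exp_nat_mul]
    congr 1
    push_cast
    ring
  have hwinj : ∀ i i', w i = w i' → z i = z i' := by
    intro i i' hii
    obtain ⟨m, hm⟩ := Complex.exp_eq_exp_iff_exists_int.1 hii
    have h1 : (z i - z i') * h = m * (2 * Real.pi * Complex.I) := by rw [sub_mul, hm]; ring
    have h2 := congrArg Complex.im h1
    have h3 : h * (z i - z i').im = m * (2 * Real.pi) := by
      simp [-Complex.sub_im] at h2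
      linarith
    have h4 := hh i i'
    rw [h3, abs_mul, abs_of_pos Real.two_pi_pos] at h4
    have h5 : |(m : ℝ)| < 1 := by
      by_contra! hge
      have := Real.two_pi_pos
      nlinarith
    have h6 : m = 0 := by
      have : |m| < 1 := by exact_mod_cast h5
      exact Int.abs_lt_one_iff.1 this
    rw [h6, Int.cast_zero, zero_mul, mul_eq_zero, sub_eq_zero] at h1
    exact h1.resolve_right (by exact_mod_cast h0)
  set p : Polynomial ℂ := ∑ j : Fin n, Polynomial.C (a j) * Polynomial.X ^ (j : ℕ) with hp
  have hcoeff : ∀ j : Fin n, p.coeff j = a j := by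
    intro j
    rw [hp, Polynomial.finsetSum_coeff, Finset.sum_eq_single j]
    · simp
    · intro l _ hl
      rw [Polynomial.coeff_C_mul_X_pow, if_neg fun h => hl (Fin.ext h.symm)]
    · simp
  have hp0 : p ≠ 0 := by
    rintro h
    apply ha0
    ext j
    rw [← hcoeff, h]
    simp
  have hdeg : p.degree < n := Polynomial.degree_sum_fin_lt a
  have heval : ∀ i, p.eval (w i) = ∑ j : Fin n, a j * w i ^ (j : ℕ) := by
    intro i
    simp [hp, Polynomial.eval_finsetSum]
  have hderiv : ∀ i, w i * (Polynomial.derivative p).eval (w i) =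
      ∑ j : Fin n, a j * ((j : ℕ) * w i ^ (j : ℕ)) := by
    intro i
    simp only [hp, Polynomial.derivative_sum, Polynomial.derivative_C_mul_X_pow,
      Polynomial.eval_finsetSum, Finset.mul_sum]
    refine Finset.sum_congr rfl fun j _ => ?_
    rcases Nat.eq_zero_or_pos (j : ℕ) with hj | hj
    · simp [hj]
    · obtain ⟨m, hm⟩ := Nat.exists_eq_succ_of_ne_zero hj.ne'
      simp [hm]
      ring
  have hroot0 : ∀ i, (∀ i' < i, z i' ≠ z i) → p.IsRoot (w i) := by
    intro i hi
    have h1 := hrow i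
    simp only [confluentExp_of_forall hi, hexp] at h1
    rw [Polynomial.IsRoot, heval, ← h1]
    exact Finset.sum_congr rfl fun j _ => mul_comm _ _
  have hroot1 : ∀ i i', i' < i → z i' = z i → (Polynomial.derivative p).IsRoot (w i) := by
    intro i i' hi hi'
    have h1 := hrow i
    simp only [confluentExp_of_exists hi hi', hexp] at h1
    have h2 : (h : ℂ) * (w i * (Polynomial.derivative p).eval (w i)) = 0 := by
      rw [hderiv, Finset.mul_sum, ← h1]
      refine Finset.sum_congr rfl fun j _ => ?_
      push_cast
      ring
    have h3 : (h : ℂ) ≠ 0 := by exact_mod_cast h0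
    simpa [h3, hw0 i] using h2
  have hcount : Multiset.map w Finset.univ.val ≤ p.roots := by
    rw [Multiset.le_iff_count]
    intro x
    rw [Polynomial.count_roots, Multiset.count_map]
    set A := Finset.univ.filter fun i => x = w i with hA
    change A.card ≤ _
    have hAz : ∀ i ∈ A, ∀ i' ∈ A, z i = z i' := fun i hi i' hi' =>
      hwinj i i' ((Finset.mem_filter.1 hi).2.symm.trans (Finset.mem_filter.1 hi').2)
    rcases A.eq_empty_or_nonempty with hemp | hne
    · simp [hemp]
    · set i₁ := A.min' hne
      have hi₁ : i₁ ∈ A := A.min'_mem hne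
      have hx₁ : x = w i₁ := (Finset.mem_filter.1 hi₁).2
      have hr0 : p.IsRoot x := by
        rw [hx₁]
        refine hroot0 i₁ fun i' hi' heq => ?_
        have : i' ∈ A := Finset.mem_filter.2 ⟨Finset.mem_univ _, by rw [hx₁, hw]; simp only [heq]⟩
        exact absurd (A.min'_le i' this) (not_le.2 hi')
      rcases (A.erase i₁).eq_empty_or_nonempty with hemp | hne'
      · have : A.card = 1 := by
          rw [← Finset.card_erase_add_one hi₁, hemp, Finset.card_empty]
        rw [this]
        exact (Polynomial.rootMultiplicity_pos hp0).2 hr0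
      · obtain ⟨i₂, hi₂⟩ := hne'
        have hi₂A := Finset.mem_of_mem_erase hi₂
        have hlt : i₁ < i₂ :=
          lt_of_le_of_ne (A.min'_le i₂ hi₂A) (Finset.ne_of_mem_erase hi₂).symm
        have hr1 : (Polynomial.derivative p).IsRoot x := by
          rw [(Finset.mem_filter.1 hi₂A).2]
          exact hroot1 i₂ i₁ hlt (hAz _ hi₁ _ hi₂A)
        have hcard : A.card ≤ 2 := by
          have hsub : A ⊆ {i₁, i₂} := by
            intro i hi
            rw [Finset.mem_insert, Finset.mem_singleton]
            by_contra! hcon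
            have hlt' : i₁ < i := lt_of_le_of_ne (A.min'_le i hi) hcon.1.symm
            rcases lt_or_gt_of_ne hcon.2 with h' | h'
            · exact hz i₁ i i₂ hlt' h' (hAz _ hi₁ _ hi) (hAz _ hi _ hi₂A)
            · exact hz i₁ i₂ i hlt h' (hAz _ hi₁ _ hi₂A) (hAz _ hi₂A _ hi)
          exact (Finset.card_le_card hsub).trans Finset.card_le_two
        exact hcard.trans ((Polynomial.one_lt_rootMultiplicity_iff_isRoot hp0).2 ⟨hr0, hr1⟩)
  have h1 := Multiset.card_le_card hcount
  rw [Multiset.card_map] at h1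
  have h2 : (Finset.univ : Finset (Fin n)).val.card = n := by simp
  rw [h2] at h1
  have h3 := p.card_roots hp0
  have h4 : ((Multiset.card p.roots : ℕ) : WithBot ℕ) < n := h3.trans_lt hdeg
  exact absurd h1 (not_le.2 (by exact_mod_cast h4))

theorem exists_monotone_sampleDet_confluentExp_ne_zero
    (hz : ∀ i i' i'', i < i' → i' < i'' → z i = z i' → z i' ≠ z i'') :
    ∃ s : Fin n → ℝ, Monotone s ∧ (∀ i, s i ∈ Set.Icc (-1 : ℝ) 0) ∧
      sampleDet (fun i (u : ℝ) => confluentExp z i u) s ≠ 0 := by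
  set h : ℝ := 1 / (n + ∑ i, ‖z i‖ + 1) with hh
  have hsum : 0 ≤ ∑ i, ‖z i‖ := Finset.sum_nonneg fun _ _ => norm_nonneg _
  have hd : 0 < (n + ∑ i, ‖z i‖ + 1 : ℝ) := by positivity
  have hpos : 0 < h := by positivity
  have hn : n * h ≤ 1 := by
    rw [hh, mul_one_div, div_le_one hd]
    linarith
  have hzh : ∀ i, h * ‖z i‖ ≤ 1 := fun i => by
    have := Finset.single_le_sum (f := fun i => ‖z i‖) (fun _ _ => norm_nonneg _)
      (Finset.mem_univ i)
    rw [hh, one_div_mul_eq_div, div_le_one hd]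
    have : (0 : ℝ) ≤ n := Nat.cast_nonneg n
    linarith
  have hne := sampleDet_confluentExp_ne_zero hz hpos.ne' fun i i' => by
    have h1 : |(z i - z i').im| ≤ ‖z i‖ + ‖z i'‖ := (Complex.abs_im_le_norm _).trans (norm_sub_le _ _)
    rw [abs_mul, abs_of_pos hpos]
    have := Real.pi_gt_three
    nlinarith [hzh i, hzh i']
  refine ⟨fun j => (j : ℕ) * h + -(n * h), fun i j hij => ?_, fun j => ⟨?_, ?_⟩, ?_⟩
  · have : ((i : ℕ) : ℝ) ≤ (j : ℕ) := by exact_mod_cast hij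
    simp only
    gcongr
  · have : 0 ≤ ((j : ℕ) : ℝ) * h := by positivity
    linarith
  · have h1 : ((j : ℕ) : ℝ) ≤ n := by exact_mod_cast j.2.le
    have h2 := mul_le_mul_of_nonneg_right h1 hpos.le
    linarith
  · rw [sampleDet_confluentExp_add hz (fun j => (j : ℕ) * h) (-(n * h))]
    exact mul_ne_zero (Complex.exp_ne_zero _) hne

theorem isDelaySolution_confluentExp {b₀ : ℝ} (hroot : ∀ i, charFun b₀ (z i) = 0)
    (hdouble : ∀ i i', i < i' → z i = z i' → z i' = -1) (i : Fin n) :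
    IsDelaySolution (fun _ => b₀) fun t : ℝ => confluentExp z i t := by
  have hderiv : ∀ t : ℝ, HasDerivAt (fun t : ℝ => confluentExp z i t)
      (-(b₀ • confluentExp z i ((t - 1 : ℝ) : ℂ))) t := by
    intro t
    have h1 : b₀ * Complex.exp (-z i) = -z i := by
      have : z i + b₀ * Complex.exp (-z i) = 0 := hroot i
      exact eq_neg_of_add_eq_zero_right this
    have h2 : Complex.exp (z i * ((t - 1 : ℝ) : ℂ)) =
        Complex.exp (z i * t) * Complex.exp (-z i) := by
      rw [← Complex.exp_add]
      congr 1
      push_cast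
      ring
    have h3 : HasDerivAt (fun w : ℂ => Complex.exp (z i * w)) (Complex.exp (z i * t) * z i)
        (t : ℂ) := by
      have := ((hasDerivAt_id (t : ℂ)).const_mul (z i)).cexp
      simpa using this
    by_cases hi : ∃ i' < i, z i' = z i
    · obtain ⟨i', hi1, hi2⟩ := hi
      simp only [confluentExp_of_exists hi1 hi2]
      convert! ((hasDerivAt_id (t : ℂ)).mul h3).comp_ofReal using 1
      rw [h2, Complex.real_smul]
      simp only [id]
      push_cast
      have h4 := hdouble i' i hi1 hi2
      linear_combination (-((t : ℂ) - 1)) * Complex.exp (z i * t) * h1 -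
        Complex.exp (z i * t) * h4
    · push Not at hi
      simp only [confluentExp_of_forall hi]
      convert! h3.comp_ofReal using 1
      rw [h2, Complex.real_smul]
      linear_combination (-Complex.exp (z i * t)) * h1
  have hc : Continuous fun t : ℝ => confluentExp z i t :=
    (differentiable_confluentExp i).continuous.comp Complex.continuous_ofReal
  refine ⟨hc, fun t₀ t _ _ => ?_⟩
  have hci : Continuous fun t : ℝ => b₀ • confluentExp z i ((t - 1 : ℝ) : ℂ) :=
    (hc.comp (continuous_sub_right (1 : ℝ))).const_smul b₀
  have h := intervalIntegral.integral_eq_sub_of_hasDerivAt (a := t₀) (b := t)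
    (fun u _ => hderiv u) (hci.neg.intervalIntegrable _ _)
  rw [intervalIntegral.integral_neg] at h
  rw [sub_eq_add_neg, h]
  simp

end Exponentials

section Roots

variable {b₀ : ℝ} {ζ : ℕ → ℂ}

theorem deriv_charFun (b₀ : ℝ) (z : ℂ) :
    deriv (_root_.charFun b₀) z = 1 - b₀ * Complex.exp (-z) := by
  have h : HasDerivAt (fun z : ℂ => z + (b₀ : ℂ) * Complex.exp (-z))
      (1 + b₀ * (Complex.exp (-z) * -1)) z :=
    (hasDerivAt_id z).add ((hasDerivAt_id z).neg.cexp.const_mul (b₀ : ℂ))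
  exact h.deriv.trans (by ring)

theorem deriv_deriv_charFun (b₀ : ℝ) (z : ℂ) :
    deriv (deriv (_root_.charFun b₀)) z = b₀ * Complex.exp (-z) := by
  rw [funext (deriv_charFun b₀)]
  have h : HasDerivAt (fun z : ℂ => 1 - (b₀ : ℂ) * Complex.exp (-z))
      (0 - b₀ * (Complex.exp (-z) * -1)) z :=
    (hasDerivAt_const z (1 : ℂ)).sub ((hasDerivAt_id z).neg.cexp.const_mul (b₀ : ℂ))
  exact h.deriv.trans (by ring)

theorem IsRootEnum.iteratedDeriv_charFun_eq_zero (hζ : IsRootEnum b₀ ζ) {z : ℂ} {A : Finset ℕ}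
    (hA : ∀ k ∈ A, 1 ≤ k ∧ ζ k = z) {j : ℕ} (hj : j < A.card) :
    iteratedDeriv j (_root_.charFun b₀) z = 0 := by
  obtain ⟨l, hl⟩ : A.Nonempty := Finset.card_pos.1 (by omega)
  have hz : _root_.charFun b₀ z = 0 := (hA l hl).2 ▸ hζ.2.1 l (hA l hl).1
  have hcard : (Nat.card {k : ℕ | 1 ≤ k ∧ ζ k = z} : ℕ∞) = analyticOrderAt (_root_.charFun b₀) z :=
    hζ.2.2 z hz
  have hne : Nat.card {k : ℕ | 1 ≤ k ∧ ζ k = z} ≠ 0 := by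
    intro h0
    rw [h0, Nat.cast_zero, eq_comm, AnalyticAt.analyticOrderAt_eq_zero (charFun_analyticAt b₀ z)]
      at hcard
    exact hcard hz
  have hfin : {k : ℕ | 1 ≤ k ∧ ζ k = z}.Finite := Nat.finite_of_card_ne_zero hne
  have hle : A.card ≤ Nat.card {k : ℕ | 1 ≤ k ∧ ζ k = z} := by
    rw [Nat.card_coe_set_eq, ← Set.ncard_coe_finset]
    exact Set.ncard_le_ncard (fun k hk => hA k hk) hfin
  have hord : (A.card : ℕ∞) ≤ analyticOrderAt (_root_.charFun b₀) z := by
    rw [← hcard]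
    exact_mod_cast hle
  exact (natCast_le_analyticOrderAt_iff_iteratedDeriv_eq_zero (charFun_analyticAt b₀ z)).1 hord j hj

theorem IsRootEnum.eq_neg_one (hζ : IsRootEnum b₀ ζ) {j l : ℕ} (hj : 1 ≤ j) (hjl : j < l)
    (h : ζ j = ζ l) : ζ l = -1 := by
  have h1 : deriv (_root_.charFun b₀) (ζ l) = 0 := by
    rw [← iteratedDeriv_one]
    refine hζ.iteratedDeriv_charFun_eq_zero (A := {j, l}) ?_ (by rw [Finset.card_pair hjl.ne]; decide)
    simp only [Finset.mem_insert, Finset.mem_singleton]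
    rintro k (rfl | rfl)
    · exact ⟨hj, h⟩
    · exact ⟨by omega, rfl⟩
  rw [deriv_charFun] at h1
  have h2 : ζ l + b₀ * Complex.exp (-ζ l) = 0 := hζ.2.1 l (by omega)
  linear_combination h1 + h2

theorem IsRootEnum.ne_of_eq (hζ : IsRootEnum b₀ ζ) (hb₀ : b₀ ≠ 0) {i j l : ℕ} (hi : 1 ≤ i)
    (hij : i < j) (hjl : j < l) (h : ζ i = ζ j) : ζ j ≠ ζ l := by
  intro h'
  have h1 : deriv (deriv (_root_.charFun b₀)) (ζ l) = 0 := by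
    rw [← iteratedDeriv_one, ← iteratedDeriv_succ']
    refine hζ.iteratedDeriv_charFun_eq_zero (A := {i, j, l}) ?_ ?_
    · simp only [Finset.mem_insert, Finset.mem_singleton]
      rintro k (rfl | rfl | rfl)
      · exact ⟨hi, h.trans h'⟩
      · exact ⟨by omega, h'⟩
      · exact ⟨by omega, rfl⟩
    · rw [Finset.card_eq_three.2 ⟨i, j, l, hij.ne, (hij.trans hjl).ne, hjl.ne, rfl⟩]
      decide
  rw [deriv_deriv_charFun] at h1
  simp [hb₀, Complex.exp_ne_zero] at h1

end Roots

section LowerBound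

theorem exists_norm_sampleDet_confluentExp_le {n : ℕ} (z : Fin n → ℂ) :
    ∃ C : ℝ, 0 < C ∧ ∀ s : Fin n → ℝ, (∀ i, s i ∈ Set.Icc (-1 : ℝ) 0) →
      ‖sampleDet (fun i (u : ℝ) => confluentExp z i u) s‖ ≤
        C * ∏ i, ∏ j ∈ Finset.Ioi i, |s j - s i| := by
  have hK : ∀ i, ∃ K : ℝ, ∀ w : ℂ, ‖w‖ ≤ 2 → ‖confluentExp z i w‖ ≤ K := by
    intro i
    obtain ⟨K, hK⟩ := (isCompact_closedBall (0 : ℂ) 2).exists_bound_of_continuousOn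
      (differentiable_confluentExp (z := z) i).continuous.continuousOn
    exact ⟨K, fun w hw => hK w (mem_closedBall_zero_iff.2 hw)⟩
  choose K hK using hK
  obtain ⟨C, hC0, hC⟩ := exists_norm_sampleDet_le n (∑ i, |K i|)
  refine ⟨C + 1, by linarith, fun s hs => ?_⟩
  have h := hC (fun i => confluentExp z i) (fun i => differentiable_confluentExp i)
    (fun i w hw => ((hK i w hw).trans (le_abs_self _)).trans
      (Finset.single_le_sum (f := fun i => |K i|) (fun _ _ => abs_nonneg _) (Finset.mem_univ i)))
    s hs
  refine h.trans (mul_le_mul_of_nonneg_right (by linarith) ?_)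
  exact Finset.prod_nonneg fun _ _ => Finset.prod_nonneg fun _ _ => abs_nonneg _

theorem sampleDet_pow {n : ℕ} {g : Fin n → ℝ → ℝ} {s : Fin n → ℝ}
    (hg : ∀ i j, g i (s j) = s j ^ (i : ℕ)) :
    sampleDet g s = ∏ i, ∏ j ∈ Finset.Ioi i, (s j - s i) := by
  rw [← Matrix.det_vandermonde, ← Matrix.det_transpose, sampleDet]
  congr 1
  ext i j
  simp [hg, Matrix.vandermonde_apply]

theorem IsRootEnum.exists_le_sampleDet {b₀ : ℝ} {ζ : ℕ → ℂ} (hζ : IsRootEnum b₀ ζ) {b : ℝ → ℝ}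
    (hb : LocallyIntegrable b) {k : ℕ} (hk : 1 ≤ k) (hb₀ : 0 < (-1) ^ k * b₀)
    (hbb : ∀ᵐ u, (-1) ^ k * b₀ ≤ (-1) ^ k * b u) {g : Fin k → ℝ → ℝ}
    (hg : ∀ i, IsDelaySolution b (g i))
    (hinit : ∀ i, ∀ θ ∈ Set.Icc (-1 : ℝ) 0, g i θ = θ ^ (i : ℕ)) :
    ∃ s : Fin k → ℝ, (∀ i, s i ∈ Set.Icc (-1 : ℝ) 0) ∧ ∃ c : ℝ, 0 < c ∧ ∀ t : ℝ, 0 ≤ t →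
      c * Real.exp (t * ∑ j ∈ Finset.Icc 1 k, (ζ j).re) ≤ sampleDet g fun i => s i + t := by
  obtain ⟨n, rfl⟩ : ∃ n, k = n + 1 := ⟨k - 1, by omega⟩
  set z : Fin (n + 1) → ℂ := fun i => ζ (i + 1) with hzdef
  have hb₀' : b₀ ≠ 0 := by
    rintro rfl
    simp at hb₀
  have hz : ∀ i i' i'', i < i' → i' < i'' → z i = z i' → z i' ≠ z i'' := by
    intro i i' i'' h1 h2 h
    have h1' : (i : ℕ) < i' := h1
    have h2' : (i' : ℕ) < i'' := h2
    exact hζ.ne_of_eq hb₀' (by omega) (by omega) (by omega) h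
  have hdouble : ∀ i i', i < i' → z i = z i' → z i' = -1 := by
    intro i i' h1 h
    have h1' : (i : ℕ) < i' := h1
    exact hζ.eq_neg_one (by omega) (by omega) h
  have hroot : ∀ i, _root_.charFun b₀ (z i) = 0 := fun i => hζ.2.1 _ (by omega)
  obtain ⟨C, hC0, hC⟩ := exists_norm_sampleDet_confluentExp_le z
  obtain ⟨s, hs, hsI, hs0⟩ := exists_monotone_sampleDet_confluentExp_ne_zero hz
  set v : Fin (n + 1) → ℝ := Fin.cons C fun _ => 1 with hv
  have hvdet : ∀ s, sampleDet (fun i u => v i * g i u) s = C * sampleDet g s := by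
    intro s
    have h := Matrix.det_mul_column v (Matrix.of fun i j => g i (s j))
    rw [show ∏ i, v i = C by simp [hv, Fin.prod_univ_succ]] at h
    exact h
  have hcmp := norm_sampleDet_le_sampleDet hb (fun i => isDelaySolution_confluentExp hroot hdouble i)
    (g := fun i u => v i * g i u) (fun i => ⟨(hg i).1.const_mul _, fun t₀ t h0 h1 => ?_⟩)
    hb₀.le hbb ?_
  · refine ⟨s, hsI, ‖sampleDet (fun i (u : ℝ) => confluentExp z i u) s‖ / C,
      div_pos (norm_pos_iff.2 hs0) hC0, fun t ht => ?_⟩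
    have h := hcmp (fun i => s i + t) (fun i j hij => by simpa using hs hij)
      (by linarith [(hsI 0).1]) (by linarith [(hsI 0).1, (hsI (Fin.last n)).2])
    rw [hvdet, sampleDet_confluentExp_add hz, norm_mul, Complex.norm_exp] at h
    have hre : ((t : ℂ) * ∑ i, z i).re = t * ∑ j ∈ Finset.Icc 1 (n + 1), (ζ j).re := by
      rw [Complex.re_ofReal_mul, Complex.re_sum, hzdef,
        Fin.sum_univ_eq_sum_range (fun i => (ζ (i + 1)).re) (n + 1),
        Finset.range_eq_Ico, Finset.sum_Ico_add' (fun i => (ζ i).re) 0 (n + 1) 1]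
      rfl
    rw [hre] at h
    rw [div_mul_eq_mul_div, div_le_iff₀ hC0]
    linarith
  · simp only [smul_eq_mul]
    rw [(hg i).2 t₀ t h0 h1, mul_sub, ← intervalIntegral.integral_const_mul]
    congr 2
    ext u
    simp only [smul_eq_mul]
    ring
  · intro s hs hsI
    rw [hvdet, sampleDet_pow fun i j => hinit i _ (hsI j)]
    refine (hC s hsI).trans_eq ?_
    congr 1
    refine Finset.prod_congr rfl fun i _ => Finset.prod_congr rfl fun j hj => ?_
    exact abs_of_nonneg (sub_nonneg.2 (hs (Finset.mem_Ioi.1 hj).le))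

end LowerBound

section AbsolutelyContinuous

theorem AbsolutelyContinuousOnInterval.of_dist_le {X Y : Type*} [PseudoMetricSpace X]
    [PseudoMetricSpace Y] {f : ℝ → X} {g : ℝ → Y} {a b C : ℝ}
    (hg : AbsolutelyContinuousOnInterval g a b)
    (h : ∀ x ∈ Set.uIcc a b, ∀ y ∈ Set.uIcc a b, dist (f x) (f y) ≤ C * dist (g x) (g y)) :
    AbsolutelyContinuousOnInterval f a b := by
  rw [absolutelyContinuousOnInterval_iff] at hg ⊢
  intro ε hε
  obtain ⟨δ, hδ, H⟩ := hg (ε / (|C| + 1)) (by positivity)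
  refine ⟨δ, hδ, fun I hI hlt => ?_⟩
  have h1 := H I hI hlt
  rw [lt_div_iff₀ (by positivity), mul_comm] at h1
  refine lt_of_le_of_lt ?_ h1
  rw [Finset.mul_sum]
  refine Finset.sum_le_sum fun i hi => (h _ (hI.1 i hi).1 _ (hI.1 i hi).2).trans ?_
  exact mul_le_mul_of_nonneg_right (by linarith [le_abs_self C]) dist_nonneg

theorem MeasureTheory.LocallyIntegrable.norm' {E : Type*} [NormedAddCommGroup E] {f : ℝ → E}
    (hf : LocallyIntegrable f) : LocallyIntegrable fun t => ‖f t‖ := fun x =>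
  let ⟨s, hs, h⟩ := hf x
  ⟨s, hs, h.norm⟩

theorem MeasureTheory.LocallyIntegrable.intervalIntegrable' {E : Type*} [NormedAddCommGroup E]
    {f : ℝ → E} (hf : LocallyIntegrable f) (a b : ℝ) : IntervalIntegrable f volume a b :=
  (hf.integrableOn_isCompact isCompact_uIcc).intervalIntegrable

variable {E : Type*} [NormedAddCommGroup E] [NormedSpace ℝ E]

theorem MeasureTheory.LocallyIntegrable.continuous_integral {f : ℝ → E} (hf : LocallyIntegrable f)
    (a : ℝ) : Continuous fun t => ∫ u in a..t, f u :=
  intervalIntegral.continuous_primitive (fun a b => hf.intervalIntegrable' a b) a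

theorem MeasureTheory.LocallyIntegrable.absolutelyContinuousOnInterval_integral {f : ℝ → E}
    (hf : LocallyIntegrable f) (c a b : ℝ) :
    AbsolutelyContinuousOnInterval (fun t => ∫ u in c..t, f u) a b := by
  have h1 : AbsolutelyContinuousOnInterval (fun t => ∫ u in a..t, ‖f u‖) a b :=
    (hf.norm'.intervalIntegrable' a b).absolutelyContinuousOnInterval_intervalIntegral
      Set.left_mem_uIcc
  refine h1.of_dist_le (C := 1) fun x _ y _ => ?_
  rw [one_mul, dist_eq_norm, dist_eq_norm,
    intervalIntegral.integral_interval_sub_left (hf.intervalIntegrable' _ _)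
      (hf.intervalIntegrable' _ _),
    intervalIntegral.integral_interval_sub_left (hf.norm'.intervalIntegrable' _ _)
      (hf.norm'.intervalIntegrable' _ _)]
  exact intervalIntegral.norm_integral_le_abs_integral_norm

theorem AbsolutelyContinuousOnInterval.integral_eq_sub [CompleteSpace E] {F f : ℝ → E} {a b : ℝ}
    (hF : AbsolutelyContinuousOnInterval F a b) (hf : LocallyIntegrable f)
    (h : ∀ᵐ x, HasDerivAt F (f x) x) : ∫ u in a..b, f u = F b - F a := by
  have h1 := hF.sub (hf.absolutelyContinuousOnInterval_integral a a b)
  obtain ⟨C, hC⟩ := h1.const_of_ae_hasDerivAt_zero (by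
    filter_upwards [h, _root_.LocallyIntegrable.ae_hasDerivAt_integral hf] with x hx hx' _
    simpa using hx.sub (hx' a))
  have h2 := (hC b Set.right_mem_uIcc).trans (hC a Set.left_mem_uIcc).symm
  simp only [Pi.sub_apply, intervalIntegral.integral_same, sub_zero] at h2
  rw [← h2]
  abel

theorem AbsolutelyContinuousOnInterval.exp {f : ℝ → ℝ} {a b : ℝ}
    (hf : AbsolutelyContinuousOnInterval f a b) :
    AbsolutelyContinuousOnInterval (fun t => Real.exp (f t)) a b := by
  obtain ⟨C, hC⟩ := hf.exists_bound
  refine hf.of_dist_le (C := Real.exp C) fun x hx y hy => ?_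
  have hx' := (le_abs_self _).trans (hC x hx)
  have hy' := (le_abs_self _).trans (hC y hy)
  have key : ∀ p q : ℝ, p ≤ C → q ≤ p → Real.exp p - Real.exp q ≤ Real.exp C * (p - q) := by
    intro p q hp hqp
    have h1 := Real.add_one_le_exp (q - p)
    have h2 : Real.exp q = Real.exp p * Real.exp (q - p) := by rw [← Real.exp_add]; congr 1; ring
    have h3 := Real.exp_le_exp.2 hp
    have h4 := Real.exp_pos p
    rw [h2]
    nlinarith
  rw [Real.dist_eq, Real.dist_eq]
  rcases le_total (f y) (f x) with h | h
  · rw [abs_of_nonneg (sub_nonneg.2 (Real.exp_le_exp.2 h)), abs_of_nonneg (sub_nonneg.2 h)]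
    exact key _ _ hx' h
  · rw [abs_sub_comm, abs_sub_comm (f x), abs_of_nonneg (sub_nonneg.2 (Real.exp_le_exp.2 h)),
      abs_of_nonneg (sub_nonneg.2 h)]
    exact key _ _ hy' h

theorem integral_exp_integral_smul [CompleteSpace E] {a : ℝ → ℝ} {f : ℝ → E}
    (ha : LocallyIntegrable a) (hf : LocallyIntegrable f) (c : E) (s t : ℝ) :
    ∫ u in s..t, ((a u * Real.exp (∫ v in (0 : ℝ)..u, a v)) • (c + ∫ v in s..u, f v) +
        Real.exp (∫ v in (0 : ℝ)..u, a v) • f u) =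
      Real.exp (∫ v in (0 : ℝ)..t, a v) • (c + ∫ v in s..t, f v) -
        Real.exp (∫ v in (0 : ℝ)..s, a v) • c := by
  have hA := ha.continuous_integral 0
  have hF := hf.continuous_integral s
  have hconst : AbsolutelyContinuousOnInterval (fun _ : ℝ => c) s t :=
    (LipschitzWith.const c).lipschitzOnWith.absolutelyContinuousOnInterval
  have hac := (ha.absolutelyContinuousOnInterval_integral 0 s t).exp.smul
    (hconst.add (hf.absolutelyContinuousOnInterval_integral s s t))
  have hli : LocallyIntegrable fun u => (a u * Real.exp (∫ v in (0 : ℝ)..u, a v)) •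
      (c + ∫ v in s..u, f v) + Real.exp (∫ v in (0 : ℝ)..u, a v) • f u :=
    LocallyIntegrable.add
      ((ha.mul_continuous (Real.continuous_exp.comp hA)).smul_continuous (continuous_const.add hF))
      (hf.continuous_smul (Real.continuous_exp.comp hA))
  have h := hac.integral_eq_sub hli (by
    filter_upwards [_root_.LocallyIntegrable.ae_hasDerivAt_integral ha, _root_.LocallyIntegrable.ae_hasDerivAt_integral hf] with x hx hx'
    have h1 := (hx 0).exp.smul ((hx' s).const_add c)
    convert! h1 using 1
    rw [add_comm, mul_comm])
  rw [h]
  simp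

theorem integral_mul_exp_integral {a : ℝ → ℝ} (ha : LocallyIntegrable a) (s t : ℝ) :
    ∫ u in s..t, a u * Real.exp (∫ v in (0 : ℝ)..u, a v) =
      Real.exp (∫ v in (0 : ℝ)..t, a v) - Real.exp (∫ v in (0 : ℝ)..s, a v) := by
  simpa using integral_exp_integral_smul ha (f := fun _ => (0 : ℝ))
    (locallyIntegrable_const 0) (1 : ℝ) s t

end AbsolutelyContinuous

section DelaySolutions

variable {E : Type*} [NormedAddCommGroup E] [NormedSpace ℝ E]

theorem locallyIntegrable_smul_delay {b : ℝ → ℝ} (hb : LocallyIntegrable b) {y : ℝ → E}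
    (hy : Continuous y) : LocallyIntegrable fun u => b u • y (u - 1) :=
  hb.smul_continuous (hy.comp (continuous_sub_right (1 : ℝ)))

/-- One step of the method of steps for `y'(t) = -b(t) y(t-1)` with initial function `φ`. -/
def delayStep (b : ℝ → ℝ) (φ y : ℝ → E) (t : ℝ) : E :=
  φ (min t 0) - ∫ u in (0 : ℝ)..max t 0, b u • y (u - 1)

theorem continuous_delayStep {b : ℝ → ℝ} (hb : LocallyIntegrable b) {φ y : ℝ → E}
    (hφ : Continuous φ) (hy : Continuous y) : Continuous (delayStep b φ y) :=
  (hφ.comp (continuous_id.min continuous_const)).sub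
    (((locallyIntegrable_smul_delay hb hy).continuous_integral 0).comp
      (continuous_id.max continuous_const))

theorem delayStep_iterate_succ_eq (b : ℝ → ℝ) (φ : ℝ → E) (n : ℕ) {t : ℝ} (ht : t ≤ n) :
    (delayStep b φ)^[n + 1] φ t = (delayStep b φ)^[n] φ t := by
  induction n generalizing t with
  | zero =>
    have : t ≤ 0 := by simpa using ht
    simp [delayStep, this]
  | succ n ih =>
    rw [Function.iterate_succ_apply' _ (n + 1), Function.iterate_succ_apply' _ n, delayStep,
      delayStep]
    congr 1
    refine intervalIntegral.integral_congr fun u hu => ?_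
    rw [Set.uIcc_of_le (le_max_right _ _)] at hu
    have h1 : u ≤ (n : ℝ) + 1 := hu.2.trans (max_le (by exact_mod_cast ht) (by positivity))
    rw [← Function.iterate_succ_apply' (delayStep b φ) n, ih (by linarith)]

theorem exists_isDelaySolution {b : ℝ → ℝ} (hb : LocallyIntegrable b) {φ : ℝ → E}
    (hφ : Continuous φ) : ∃ y, IsDelaySolution b y ∧ ∀ t ≤ 0, y t = φ t := by
  set F : ℕ → ℝ → E := fun n => (delayStep b φ)^[n] φ with hF
  have hFc : ∀ n, Continuous (F n) := by
    intro n
    induction n with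
    | zero => exact hφ
    | succ n ih =>
      simp only [hF, Function.iterate_succ_apply']
      exact continuous_delayStep hb hφ ih
  have hFF : ∀ n m : ℕ, n ≤ m → ∀ t : ℝ, t ≤ n → F m t = F n t := by
    intro n m hnm t ht
    induction m, hnm using Nat.le_induction with
    | base => rfl
    | succ m hm ih =>
      rw [← ih]
      exact delayStep_iterate_succ_eq b φ m (ht.trans (by exact_mod_cast hm))
  set y : ℝ → E := fun t => F ⌈t⌉₊ t with hy
  have hyF : ∀ (n : ℕ) (t : ℝ), t ≤ n → y t = F n t := fun n t ht =>
    (hFF _ _ (Nat.ceil_le.2 ht) t (Nat.le_ceil t)).symm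
  have hyc : Continuous y := by
    rw [continuous_iff_continuousAt]
    intro t
    obtain ⟨n, hn⟩ := exists_nat_gt t
    refine (hFc n).continuousAt.congr ?_
    filter_upwards [Iio_mem_nhds hn] with u hu
    exact (hyF n u (le_of_lt hu)).symm
  have hbint : ∀ t, 0 ≤ t → y t = φ 0 - ∫ u in (0 : ℝ)..t, b u • y (u - 1) := by
    intro t ht
    obtain ⟨n, hn⟩ := exists_nat_ge t
    rw [hyF (n + 1) t (hn.trans (by exact_mod_cast Nat.le_succ n))]
    simp only [hF, Function.iterate_succ_apply', delayStep, min_eq_right ht, max_eq_left ht]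
    congr 1
    refine intervalIntegral.integral_congr fun u hu => ?_
    rw [Set.uIcc_of_le ht] at hu
    rw [hyF n (u - 1) (by linarith [hu.2])]
  have hli := locallyIntegrable_smul_delay hb hyc
  refine ⟨y, ⟨hyc, fun t₀ t h0 h1 => ?_⟩, fun t ht => ?_⟩
  · rw [hbint t (h0.trans h1), hbint t₀ h0, sub_sub, intervalIntegral.integral_add_adjacent_intervals
      (hli.intervalIntegrable' _ _) (hli.intervalIntegrable' _ _)]
  · rw [hyF 0 t (by simpa using ht)]
    rfl

theorem MeasureTheory.LocallyIntegrable.integral_abs_mono {b : ℝ → ℝ} (hb : LocallyIntegrable b)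
    {s t : ℝ} (h : s ≤ t) : ∫ u in (0 : ℝ)..s, |b u| ≤ ∫ u in (0 : ℝ)..t, |b u| := by
  have hb' : LocallyIntegrable fun u => |b u| := hb.norm'
  rw [← sub_nonneg, intervalIntegral.integral_interval_sub_left (hb'.intervalIntegrable' _ _)
    (hb'.intervalIntegrable' _ _)]
  exact intervalIntegral.integral_nonneg h fun _ _ => abs_nonneg _

theorem IsDelaySolution.norm_le {b : ℝ → ℝ} (hb : LocallyIntegrable b) {y : ℝ → E}
    (hy : IsDelaySolution b y) {K : ℝ} (hK : ∀ θ ∈ Set.Icc (-1 : ℝ) 0, ‖y θ‖ ≤ K) {t : ℝ}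
    (ht : 0 ≤ t) : ‖y t‖ ≤ K * Real.exp (∫ u in (0 : ℝ)..t, |b u|) := by
  have hb' : LocallyIntegrable fun u => |b u| := hb.norm'
  have hK0 : 0 ≤ K := (norm_nonneg _).trans (hK 0 (by simp))
  have hB0 : ∀ t, 0 ≤ t → 0 ≤ ∫ u in (0 : ℝ)..t, |b u| := fun t ht =>
    intervalIntegral.integral_nonneg ht fun _ _ => abs_nonneg _
  have key : ∀ (n : ℕ) (t : ℝ), 0 ≤ t → t ≤ n → ‖y t‖ ≤ K * Real.exp (∫ u in (0 : ℝ)..t, |b u|) := by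
    intro n
    induction n with
    | zero =>
      intro t h0 h1
      obtain rfl : t = 0 := le_antisymm (by simpa using h1) h0
      simpa using hK 0 (by simp)
    | succ n ih =>
      intro t h0 h1
      have hexp := hb'.mul_continuous (Real.continuous_exp.comp (hb'.continuous_integral 0))
      have h2 : ‖∫ u in (0 : ℝ)..t, b u • y (u - 1)‖ ≤
          ∫ u in (0 : ℝ)..t, K * (|b u| * Real.exp (∫ v in (0 : ℝ)..u, |b v|)) := by
        refine intervalIntegral.norm_integral_le_of_norm_le h0 (Filter.Eventually.of_forall ?_)
          ((hexp.intervalIntegrable' 0 t).const_mul K)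
        intro u hu
        have h3 : ‖y (u - 1)‖ ≤ K * Real.exp (∫ v in (0 : ℝ)..u, |b v|) := by
          rcases le_total (u - 1) 0 with hu1 | hu1
          · refine (hK _ ⟨by linarith [hu.1], hu1⟩).trans (le_mul_of_one_le_right hK0 ?_)
            exact Real.one_le_exp (hB0 u hu.1.le)
          · refine (ih (u - 1) hu1 ?_).trans ?_
            · have := hu.2.trans h1
              push_cast at this
              linarith
            · gcongr
              exact hb.integral_abs_mono (by linarith)
        rw [norm_smul, Real.norm_eq_abs]
        calc |b u| * ‖y (u - 1)‖ ≤ |b u| * (K * Real.exp (∫ v in (0 : ℝ)..u, |b v|)) := by gcongr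
          _ = _ := by ring
      rw [intervalIntegral.integral_const_mul, integral_mul_exp_integral hb'] at h2
      rw [hy.2 0 t le_rfl h0]
      have h4 := hK 0 (by simp)
      simp only [intervalIntegral.integral_same, Real.exp_zero] at h2
      linarith [norm_sub_le (y 0) (∫ u in (0 : ℝ)..t, b u • y (u - 1))]
  obtain ⟨n, hn⟩ := exists_nat_ge t
  exact key n t ht hn

theorem IsDelaySolution.exp_smul_eq [CompleteSpace E] {α β b : ℝ → ℝ} (hα : LocallyIntegrable α)
    (hbl : LocallyIntegrable b) (hb : ∀ t, b t = β t * Real.exp (∫ s in (t - 1)..t, α s))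
    {y : ℝ → E} (hy : IsDelaySolution b y) {t₀ t : ℝ} (h0 : 0 ≤ t₀) (h1 : t₀ ≤ t) :
    Real.exp (-∫ s in (0 : ℝ)..t, α s) • y t = Real.exp (-∫ s in (0 : ℝ)..t₀, α s) • y t₀ -
      ∫ u in t₀..t, (α u • Real.exp (-∫ s in (0 : ℝ)..u, α s) • y u +
        β u • Real.exp (-∫ s in (0 : ℝ)..(u - 1), α s) • y (u - 1)) := by
  have h := integral_exp_integral_smul hα.neg (locallyIntegrable_smul_delay hbl hy.1).neg (y t₀) t₀ t
  simp only [Pi.neg_apply, intervalIntegral.integral_neg, ← sub_eq_add_neg] at h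
  rw [← hy.2 t₀ t h0 h1] at h
  rw [eq_sub_iff_add_eq, ← eq_sub_iff_add_eq', ← neg_sub, ← h, ← intervalIntegral.integral_neg]
  refine intervalIntegral.integral_congr fun u hu => ?_
  rw [Set.uIcc_of_le h1] at hu
  have hA : ∫ s in (u - 1)..u, α s = (∫ s in (0 : ℝ)..u, α s) - ∫ s in (0 : ℝ)..(u - 1), α s :=
    (intervalIntegral.integral_interval_sub_left (hα.intervalIntegrable' _ _)
      (hα.intervalIntegrable' _ _)).symm
  have he : Real.exp (-∫ s in (0 : ℝ)..u, α s) * b u =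
      β u * Real.exp (-∫ s in (0 : ℝ)..(u - 1), α s) := by
    rw [hb u, hA, mul_left_comm, ← Real.exp_add]
    congr 2
    ring
  rw [← hy.2 t₀ u h0 hu.1, smul_neg, smul_smul, smul_smul, smul_smul, he]
  rw [neg_mul, neg_smul, neg_add, neg_neg, neg_neg]

end DelaySolutions

section Monodromy

theorem integral_add_period {a : ℝ → ℝ} {γ : ℝ} (ha : LocallyIntegrable a)
    (hper : ∀ᵐ t, a (t + γ) = a t) (t : ℝ) :
    ∫ u in (0 : ℝ)..(t + γ), a u = (∫ u in (0 : ℝ)..t, a u) + ∫ u in (0 : ℝ)..γ, a u := by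
  rw [← intervalIntegral.integral_add_adjacent_intervals (ha.intervalIntegrable' 0 γ)
    (ha.intervalIntegrable' γ (t + γ)), add_comm]
  congr 1
  have h := intervalIntegral.integral_comp_add_right (a := 0) (b := t) a γ
  rw [zero_add] at h
  rw [← h]
  exact intervalIntegral.integral_congr_ae (hper.mono fun u hu _ => hu)

theorem integral_nat_mul_period {a : ℝ → ℝ} {γ : ℝ} (ha : LocallyIntegrable a)
    (hper : ∀ᵐ t, a (t + γ) = a t) (n : ℕ) :
    ∫ u in (0 : ℝ)..(n * γ), a u = n * ∫ u in (0 : ℝ)..γ, a u := by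
  induction n with
  | zero => simp
  | succ n ih =>
    rw [show ((n + 1 : ℕ) : ℝ) * γ = n * γ + γ by push_cast; ring, integral_add_period ha hper, ih]
    push_cast
    ring

theorem IsDelaySolution.comp_add_smul {E : Type*} [NormedAddCommGroup E] [NormedSpace ℝ E]
    {b : ℝ → ℝ} {γ : ℝ} (hγ : 0 ≤ γ) (hper : ∀ᵐ t, b (t + γ) = b t) {y : ℝ → E}
    (hy : IsDelaySolution b y) (c : ℝ) : IsDelaySolution b fun t => c • y (t + γ) := by
  refine ⟨(hy.1.comp (continuous_add_const γ)).const_smul c, fun t₀ t h0 h1 => ?_⟩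
  simp only
  rw [hy.2 (t₀ + γ) (t + γ) (by linarith) (by linarith), smul_sub,
    ← intervalIntegral.integral_comp_add_right, ← intervalIntegral.integral_smul]
  congr 1
  refine intervalIntegral.integral_congr_ae (hper.mono fun u hu _ => ?_)
  rw [hu, smul_comm, add_sub_right_comm]

variable {α β b : ℝ → ℝ} {γ : ℝ}

theorem locallyIntegrable_coefficient (hα : LocallyIntegrable α) (hβ : LocallyIntegrable β)
    (hb : ∀ t, b t = β t * Real.exp (∫ s in (t - 1)..t, α s)) : LocallyIntegrable b := by
  have hA := hα.continuous_integral 0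
  have h : b = fun t => β t * Real.exp ((∫ s in (0 : ℝ)..t, α s) - ∫ s in (0 : ℝ)..(t - 1), α s) := by
    ext t
    rw [hb t, intervalIntegral.integral_interval_sub_left (hα.intervalIntegrable' _ _)
      (hα.intervalIntegrable' _ _)]
  rw [h]
  exact hβ.mul_continuous
    (Real.continuous_exp.comp (hA.sub (hA.comp (continuous_sub_right (1 : ℝ)))))

theorem ae_coefficient_add_period (hαper : ∀ᵐ t, α (t + γ) = α t)
    (hβper : ∀ᵐ t, β (t + γ) = β t) (hb : ∀ t, b t = β t * Real.exp (∫ s in (t - 1)..t, α s)) :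
    ∀ᵐ t, b (t + γ) = b t := by
  filter_upwards [hβper] with t ht
  rw [hb, hb, ht, show t + γ - 1 = t - 1 + γ by ring,
    ← intervalIntegral.integral_comp_add_right]
  congr 2
  exact intervalIntegral.integral_congr_ae (hαper.mono fun u hu _ => hu)

theorem exists_isDelaySolution_of_continuousMap (hα : LocallyIntegrable α)
    (hbl : LocallyIntegrable b) (φ : CC) : ∃ y : ℝ → ℂ, IsDelaySolution b y ∧
      ∀ θ : I01, y θ = Real.exp (∫ s in (0 : ℝ)..θ, α s) • φ θ := by
  have hle : (-1 : ℝ) ≤ 0 := by norm_num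
  obtain ⟨y, hy, hy0⟩ := exists_isDelaySolution hbl
    (φ := fun t => Real.exp (∫ s in (0 : ℝ)..t, α s) • Set.IccExtend hle φ t)
    ((Real.continuous_exp.comp (hα.continuous_integral 0)).smul φ.continuous.Icc_extend')
  refine ⟨y, hy, fun θ => ?_⟩
  rw [hy0 θ θ.2.2, Set.IccExtend_of_mem hle φ θ.2]

theorem IsMonodromy.exp_smul_apply {M : CC →L[ℂ] CC} (hM : IsMonodromy α β γ M)
    (hα : LocallyIntegrable α) (hαper : ∀ᵐ t, α (t + γ) = α t) (hbl : LocallyIntegrable b)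
    (hb : ∀ t, b t = β t * Real.exp (∫ s in (t - 1)..t, α s)) {y : ℝ → ℂ}
    (hy : IsDelaySolution b y) {φ : CC}
    (hφ : ∀ θ : I01, y θ = Real.exp (∫ s in (0 : ℝ)..θ, α s) • φ θ) (θ : I01) :
    Real.exp (∫ s in (0 : ℝ)..θ, α s) • M φ θ =
      Real.exp (-∫ s in (0 : ℝ)..γ, α s) • y (θ + γ) := by
  have hsol : IsSolutionC α β 0 γ fun t => Real.exp (-∫ s in (0 : ℝ)..t, α s) • y t := by
    refine ⟨((Real.continuous_exp.comp (hα.continuous_integral 0).neg).smul hy.1).continuousOn,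
      fun t ht => ?_⟩
    have h := hy.exp_smul_eq hα hbl hb le_rfl ht.1
    simpa only [Complex.real_smul] using h
  have h := hM φ _ hsol (fun θ => by
    simp only [hφ θ, smul_smul, ← Real.exp_add, neg_add_cancel, Real.exp_zero, one_smul]) θ
  rw [h, smul_smul, ← Real.exp_add, add_comm γ, integral_add_period hα hαper]
  congr 2
  ring

theorem IsMonodromy.exp_smul_pow_apply {M : CC →L[ℂ] CC} (hM : IsMonodromy α β γ M) (hγ : 0 ≤ γ)
    (hα : LocallyIntegrable α) (hαper : ∀ᵐ t, α (t + γ) = α t) (hbl : LocallyIntegrable b)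
    (hbper : ∀ᵐ t, b (t + γ) = b t)
    (hb : ∀ t, b t = β t * Real.exp (∫ s in (t - 1)..t, α s)) (n : ℕ) {y : ℝ → ℂ}
    (hy : IsDelaySolution b y) {φ : CC}
    (hφ : ∀ θ : I01, y θ = Real.exp (∫ s in (0 : ℝ)..θ, α s) • φ θ) (θ : I01) :
    Real.exp (∫ s in (0 : ℝ)..θ, α s) • (M ^ n) φ θ =
      Real.exp (-∫ s in (0 : ℝ)..γ, α s) ^ n • y (θ + n * γ) := by
  induction n generalizing y φ θ with
  | zero => simp [hφ]
  | succ n ih =>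
    have h := ih (hy.comp_add_smul hγ hbper (Real.exp (-∫ s in (0 : ℝ)..γ, α s))) (φ := M φ)
      (fun θ => (hM.exp_smul_apply hα hαper hbl hb hy hφ θ).symm) θ
    rw [pow_succ M, mul_apply_eq_comp, h, smul_smul, ← pow_succ]
    congr 2
    push_cast
    ring

theorem exists_norm_exp_smul_le (hα : LocallyIntegrable α) :
    ∃ K : ℝ, 0 < K ∧ ∀ (φ : CC) (θ : I01), ‖Real.exp (∫ s in (0 : ℝ)..θ, α s) • φ θ‖ ≤ K * ‖φ‖ := by
  obtain ⟨K, hK⟩ := (isCompact_Icc (a := (-1 : ℝ)) (b := 0)).exists_bound_of_continuousOn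
    (Real.continuous_exp.comp (hα.continuous_integral 0)).continuousOn
  refine ⟨K, (norm_pos_iff.2 (Real.exp_pos _).ne').trans_le (hK 0 (by simp)), fun φ θ => ?_⟩
  rw [norm_smul]
  exact mul_le_mul (hK θ θ.2) (φ.norm_coe_le_norm θ) (norm_nonneg _)
    ((norm_nonneg _).trans (hK θ θ.2))

theorem IsMonodromy.norm_le_of_isFloquetMult {M : CC →L[ℂ] CC} (hM : IsMonodromy α β γ M)
    (hγ : 0 < γ) (hα : LocallyIntegrable α) (hαper : ∀ᵐ t, α (t + γ) = α t)
    (hbl : LocallyIntegrable b) (hbper : ∀ᵐ t, b (t + γ) = b t)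
    (hb : ∀ t, b t = β t * Real.exp (∫ s in (t - 1)..t, α s)) {μ : ℂ} (hμ : IsFloquetMult M μ) :
    ‖μ‖ ≤ Real.exp (∫ s in (0 : ℝ)..γ, |b s|) * Real.exp (-∫ s in (0 : ℝ)..γ, α s) := by
  obtain ⟨-, φ, hφ0, hφ⟩ := hμ
  have hpow : ∀ n : ℕ, (M ^ n) φ = μ ^ n • φ := by
    intro n
    induction n with
    | zero => simp
    | succ n ih =>
      rw [pow_succ', mul_apply_eq_comp, ih, map_smul, hφ, smul_smul, pow_succ]
  obtain ⟨θ, hθ⟩ : ∃ θ, φ θ ≠ 0 := by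
    by_contra! h
    exact hφ0 (ContinuousMap.ext h)
  obtain ⟨K, hK0, hK⟩ := exists_norm_exp_smul_le hα
  obtain ⟨y, hy, hyφ⟩ := exists_isDelaySolution_of_continuousMap hα hbl φ
  set r := Real.exp (∫ s in (0 : ℝ)..γ, |b s|) with hr
  set e := Real.exp (-∫ s in (0 : ℝ)..γ, α s) with he
  set c := ‖Real.exp (∫ s in (0 : ℝ)..θ, α s) • φ θ‖ with hc
  have hc0 : 0 < c := norm_pos_iff.2 (smul_ne_zero (Real.exp_pos _).ne' hθ)
  have hre : 0 < r * e := mul_pos (Real.exp_pos _) (Real.exp_pos _)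
  have hbound : ∀ n : ℕ, 1 ≤ n * γ → ‖μ‖ ^ n * c ≤ K * ‖φ‖ * (r * e) ^ n := by
    intro n hn
    have h1 := hM.exp_smul_pow_apply hγ.le hα hαper hbl hbper hb n hy hyφ θ
    rw [hpow, ContinuousMap.smul_apply, smul_comm, ← he] at h1
    have h2 : ‖μ‖ ^ n * c = e ^ n * ‖y (θ + n * γ)‖ := by
      have h := congrArg norm h1
      rwa [norm_smul (μ ^ n), norm_pow, norm_smul (e ^ n), Real.norm_of_nonneg (by positivity)] at h
    have h3 := hy.norm_le hbl (K := K * ‖φ‖) (fun t ht => by rw [hyφ ⟨t, ht⟩]; exact hK φ ⟨t, ht⟩)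
      (t := θ + n * γ) (by linarith [θ.2.1])
    have h4 : Real.exp (∫ u in (0 : ℝ)..(θ + n * γ), |b u|) ≤ r ^ n := by
      have hn' := integral_nat_mul_period (a := fun u => |b u|) hbl.norm'
        (hbper.mono fun t ht => congrArg abs ht) n
      rw [hr, ← Real.exp_nat_mul, ← hn']
      exact Real.exp_le_exp.2 (hbl.integral_abs_mono (by linarith [θ.2.2]))
    rw [h2, mul_pow]
    calc e ^ n * ‖y (θ + n * γ)‖ ≤ e ^ n * (K * ‖φ‖ * r ^ n) := by
          gcongr
          exact h3.trans (by gcongr)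
      _ = _ := by ring
  by_contra! hlt
  have h1 : 1 < ‖μ‖ / (r * e) := (one_lt_div hre).2 hlt
  obtain ⟨n₀, hn₀⟩ := exists_nat_ge (1 / γ)
  have htend := (tendsto_pow_atTop_atTop_of_one_lt h1).eventually_gt_atTop (K * ‖φ‖ / c)
  obtain ⟨n, hn, hn'⟩ := (htend.and (Filter.eventually_ge_atTop n₀)).exists
  have h2 : 1 ≤ n * γ := by
    have : (n₀ : ℝ) ≤ n := by exact_mod_cast hn'
    rw [div_le_iff₀ hγ] at hn₀
    nlinarith
  have h3 := hbound n h2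
  rw [div_pow, div_lt_div_iff₀ hc0 (by positivity)] at hn
  linarith

theorem IsMonodromy.isCompactOperator_pow {M : CC →L[ℂ] CC} (hM : IsMonodromy α β γ M)
    (hγ : 0 ≤ γ) (hα : LocallyIntegrable α) (hαper : ∀ᵐ t, α (t + γ) = α t)
    (hbl : LocallyIntegrable b) (hbper : ∀ᵐ t, b (t + γ) = b t)
    (hb : ∀ t, b t = β t * Real.exp (∫ s in (t - 1)..t, α s)) {N : ℕ} (hN : 1 ≤ N * γ) :
    IsCompactOperator (M ^ N : CC →L[ℂ] CC) := by
  obtain ⟨K, hK0, hK⟩ := exists_norm_exp_smul_le hα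
  set A : ℝ → ℝ := fun t => ∫ s in (0 : ℝ)..t, α s with hA
  have hAc : Continuous A := hα.continuous_integral 0
  have hbl' : LocallyIntegrable fun u => |b u| := hbl.norm'
  set B : ℝ → ℝ := fun t => ∫ s in (0 : ℝ)..t, |b s| with hB
  have hBc : Continuous B := hbl'.continuous_integral 0
  set W := K * Real.exp (B (N * γ)) with hW
  have hW0 : 0 ≤ W := by positivity
  set p : ℝ → ℝ := fun t => Real.exp (-A t) * Real.exp (-A γ) ^ N with hp
  have hpc : Continuous p := (Real.continuous_exp.comp hAc.neg).mul continuous_const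
  have hp0 : ∀ t, 0 ≤ p t := fun t => by positivity
  have key : ∀ φ : CC, ‖φ‖ < 1 → ∃ y : ℝ → ℂ, (∀ t, -1 ≤ t → t ≤ N * γ → ‖y t‖ ≤ W) ∧
      (∀ t₀ t, 0 ≤ t₀ → t₀ ≤ t → t ≤ N * γ → ‖y t - y t₀‖ ≤ W * (B t - B t₀)) ∧
      ∀ θ : I01, (M ^ N) φ θ = p θ • y (θ + N * γ) := by
    intro φ hφ
    obtain ⟨y, hy, hyφ⟩ := exists_isDelaySolution_of_continuousMap hα hbl φ
    have hyK : ∀ θ ∈ Set.Icc (-1 : ℝ) 0, ‖y θ‖ ≤ K := fun t ht => by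
      rw [hyφ ⟨t, ht⟩]
      exact (hK φ ⟨t, ht⟩).trans (mul_le_of_le_one_right hK0.le hφ.le)
    have hyW : ∀ t, -1 ≤ t → t ≤ N * γ → ‖y t‖ ≤ W := by
      intro t h1 h2
      rcases le_total t 0 with h0 | h0
      · refine (hyK t ⟨h1, h0⟩).trans (le_mul_of_one_le_right hK0.le (Real.one_le_exp ?_))
        exact intervalIntegral.integral_nonneg (by linarith) fun _ _ => abs_nonneg _
      · refine (hy.norm_le hbl hyK h0).trans ?_
        rw [hW]
        gcongr
        exact hbl.integral_abs_mono h2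
    refine ⟨y, hyW, fun t₀ t h0 h1 h2 => ?_, fun θ => ?_⟩
    · rw [hy.2 t₀ t h0 h1, sub_sub_cancel_left, norm_neg, hB]
      simp only
      rw [intervalIntegral.integral_interval_sub_left (hbl'.intervalIntegrable' _ _)
        (hbl'.intervalIntegrable' _ _), ← intervalIntegral.integral_const_mul]
      refine intervalIntegral.norm_integral_le_of_norm_le h1 (Filter.Eventually.of_forall ?_)
        ((hbl'.intervalIntegrable' _ _).const_mul W)
      intro u hu
      rw [norm_smul, Real.norm_eq_abs, mul_comm]
      gcongr
      exact hyW _ (by linarith [hu.1]) (by linarith [hu.2])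
    · have h := hM.exp_smul_pow_apply hγ hα hαper hbl hbper hb N hy hyφ θ
      rw [hp]
      simp only
      rw [mul_smul, ← h, smul_smul, ← Real.exp_add]
      simp [hA]
  refine (isCompactOperator_iff_isCompact_closure_image_ball
    ((M ^ N : CC →L[ℂ] CC) : CC →ₗ[ℂ] CC) one_pos).2 ?_
  obtain ⟨P, hP⟩ := (isCompact_Icc (a := (-1 : ℝ)) (b := 0)).exists_bound_of_continuousOn
    hpc.continuousOn
  have hP0 : 0 ≤ P := (norm_nonneg _).trans (hP 0 (by simp))
  set S : Set CC := (M ^ N : CC →L[ℂ] CC) '' Metric.ball 0 1 with hS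
  change IsCompact (closure S)
  let e := (ContinuousMap.isometryEquivBoundedOfCompact I01 ℂ).toHomeomorph
  rw [← e.isCompact_image, e.image_closure]
  refine BoundedContinuousFunction.arzela_ascoli (Metric.closedBall (0 : ℂ) (P * W))
    (isCompact_closedBall _ _) _ ?_ ?_
  · rintro _ θ ⟨_, ⟨φ, hφ, rfl⟩, rfl⟩
    obtain ⟨y, hyW, -, hMy⟩ := key φ (mem_ball_zero_iff.1 hφ)
    rw [mem_closedBall_zero_iff]
    change ‖(M ^ N) φ θ‖ ≤ _
    rw [hMy θ, norm_smul]
    exact mul_le_mul (hP θ θ.2) (hyW _ (by linarith [θ.2.1]) (by linarith [θ.2.2])) (norm_nonneg _)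
      hP0
  · intro θ₀
    rw [Metric.equicontinuousAt_iff_right]
    intro ε hε
    have hcont : Continuous fun θ : I01 => P * (W * |B (θ + N * γ) - B (θ₀ + N * γ)|) +
        |p θ - p θ₀| * W := by fun_prop
    have hlim := hcont.tendsto θ₀
    simp only [sub_self, abs_zero, mul_zero, zero_mul, add_zero] at hlim
    filter_upwards [hlim.eventually_lt_const hε] with θ hθ
    rintro ⟨_, ⟨_, ⟨φ, hφ, rfl⟩, rfl⟩⟩
    obtain ⟨y, hyW, hyB, hMy⟩ := key φ (mem_ball_zero_iff.1 hφ)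
    change dist ((M ^ N) φ θ₀) ((M ^ N) φ θ) < ε
    refine lt_of_le_of_lt ?_ hθ
    have hB' : ‖y (θ + N * γ) - y (θ₀ + N * γ)‖ ≤ W * |B (θ + N * γ) - B (θ₀ + N * γ)| := by
      rcases le_total (θ : ℝ) θ₀ with h | h
      · rw [norm_sub_rev, abs_sub_comm]
        exact (hyB _ _ (by linarith [θ.2.1]) (by linarith) (by linarith [θ₀.2.2])).trans
          (by gcongr; exact le_abs_self _)
      · exact (hyB _ _ (by linarith [θ₀.2.1]) (by linarith) (by linarith [θ.2.2])).trans
          (by gcongr; exact le_abs_self _)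
    rw [dist_comm, dist_eq_norm, hMy, hMy]
    have heq : p θ • y (θ + N * γ) - p θ₀ • y (θ₀ + N * γ) =
        p θ • (y (θ + N * γ) - y (θ₀ + N * γ)) + (p θ - p θ₀) • y (θ₀ + N * γ) := by
      rw [smul_sub, sub_smul]
      abel
    rw [heq]
    refine (norm_add_le _ _).trans ?_
    rw [norm_smul, norm_smul]
    refine add_le_add (mul_le_mul (hP θ θ.2) hB' (norm_nonneg _) hP0) ?_
    exact mul_le_mul_of_nonneg_left (hyW _ (by linarith [θ₀.2.1]) (by linarith [θ₀.2.2]))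
      (norm_nonneg _)

end Monodromy

section Assembly

theorem IsDelaySolution.ofReal {b g : ℝ → ℝ} (hg : IsDelaySolution b g) :
    IsDelaySolution b fun t => (g t : ℂ) := by
  refine ⟨Complex.continuous_ofReal.comp hg.1, fun t₀ t h0 h1 => ?_⟩
  simp only
  rw [hg.2 t₀ t h0 h1, Complex.ofReal_sub, ← intervalIntegral.integral_ofReal]
  simp

theorem le_of_forall_mul_pow_le {a p c C : ℝ} (hp : 0 < p) (hc : 0 < c)
    (h : ∀ n : ℕ, c * a ^ n ≤ C * p ^ n) : a ≤ p := by
  by_contra! hlt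
  have htend := tendsto_pow_atTop_atTop_of_one_lt ((one_lt_div hp).2 hlt)
  obtain ⟨n, hn⟩ := (htend.eventually_gt_atTop (C / c)).exists
  have hn' := h n
  rw [div_pow, div_lt_div_iff₀ hc (by positivity)] at hn
  linarith

theorem genEig_eq_maxGenEigenspace (M : CC →L[ℂ] CC) (μ : ℂ) :
    genEig M μ = Module.End.maxGenEigenspace (M : Module.End ℂ CC) μ := by
  rw [genEig, Module.End.maxGenEigenspace, Module.End.genEigenspace_top]
  refine iSup_congr fun n => ?_
  have h : ∀ n : ℕ, (((M - μ • (1 : CC →L[ℂ] CC)) ^ n : CC →L[ℂ] CC) : CC →ₗ[ℂ] CC) =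
      ((M : Module.End ℂ CC) - μ • (1 : Module.End ℂ CC)) ^ n := by
    intro n
    induction n with
    | zero => rfl
    | succ n ih => rw [pow_succ, pow_succ, ← ih]; rfl
  rw [h n, Module.End.genEigenspace_nat]

theorem isFloquetMult_iff_hasEigenvalue {M : CC →L[ℂ] CC} {μ : ℂ} :
    IsFloquetMult M μ ↔ μ ≠ 0 ∧ Module.End.HasEigenvalue (M : Module.End ℂ CC) μ := by
  refine and_congr_right fun _ => ⟨fun ⟨φ, h0, h⟩ => ?_, fun h => ?_⟩
  · exact Module.End.hasEigenvalue_of_hasEigenvector (Module.End.hasEigenvector_iff.2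
      ⟨Module.End.mem_eigenspace_iff.2 h, h0⟩)
  · obtain ⟨φ, hφ⟩ := h.exists_hasEigenvector
    exact ⟨φ, hφ.2, hφ.apply_eq_smul⟩

/-- The determinant of the samples at `s` of a tuple of continuous functions, as an alternating
map. -/
def sampleDetMap {k : ℕ} (s : Fin k → I01) : CC [⋀^Fin k]→ₗ[ℂ] ℂ :=
  (Matrix.detRowAlternating (n := Fin k) (R := ℂ)).compLinearMap
    (LinearMap.pi fun j => (ContinuousMap.evalCLM ℂ (s j) : CC →L[ℂ] ℂ).toLinearMap)

theorem sampleDetMap_apply {k : ℕ} (s : Fin k → I01) (v : Fin k → CC) :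
    sampleDetMap s v = (Matrix.of fun i j => v i (s j)).det := rfl

theorem norm_sampleDetMap_le {k : ℕ} (s : Fin k → I01) (v : Fin k → CC) :
    ‖sampleDetMap s v‖ ≤ (Nat.factorial k : ℝ) * ∏ i, ‖v i‖ := by
  rw [sampleDetMap_apply, Matrix.det_apply]
  refine (norm_sum_le _ _).trans ?_
  have h : ∀ σ ∈ (Finset.univ : Finset (Equiv.Perm (Fin k))),
      ‖Equiv.Perm.sign σ • ∏ i, (Matrix.of fun i j => v i (s j)) (σ i) i‖ ≤ ∏ i, ‖v i‖ := by
    intro σ _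
    have h1 : ‖Equiv.Perm.sign σ • ∏ i, (Matrix.of fun i j => v i (s j)) (σ i) i‖ =
        ∏ i, ‖v (σ i) (s i)‖ := by
      rw [← norm_prod]
      rcases Int.units_eq_one_or (Equiv.Perm.sign σ) with h | h <;> simp [h, -norm_prod]
    rw [h1, ← Equiv.prod_comp σ fun i => ‖v i‖]
    exact Finset.prod_le_prod (fun _ _ => norm_nonneg _) fun i _ => (v (σ i)).norm_coe_le_norm _
  refine (Finset.sum_le_card_nsmul _ _ _ h).trans_eq ?_
  rw [Finset.card_univ, Fintype.card_perm, Fintype.card_fin, nsmul_eq_mul]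

variable {α β b : ℝ → ℝ} {γ : ℝ}

theorem IsMonodromy.norm_sampleDetMap_pow {M : CC →L[ℂ] CC} (hM : IsMonodromy α β γ M) (hγ : 0 ≤ γ)
    (hα : LocallyIntegrable α) (hαper : ∀ᵐ t, α (t + γ) = α t) (hbl : LocallyIntegrable b)
    (hbper : ∀ᵐ t, b (t + γ) = b t)
    (hb : ∀ t, b t = β t * Real.exp (∫ s in (t - 1)..t, α s)) (n : ℕ) {k : ℕ}
    {g : Fin k → ℝ → ℝ} (hg : ∀ i, IsDelaySolution b (g i)) {φ : Fin k → CC}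
    (hφ : ∀ i (θ : I01), (g i θ : ℂ) = Real.exp (∫ s in (0 : ℝ)..θ, α s) • φ i θ)
    (s : Fin k → I01) :
    ‖sampleDetMap s fun i => (M ^ n) (φ i)‖ =
      (∏ j, Real.exp (-∫ u in (0 : ℝ)..s j, α u)) *
        (Real.exp (-∫ u in (0 : ℝ)..γ, α u) ^ k) ^ n *
          |sampleDet g fun j => s j + n * γ| := by
  have h : (Matrix.of fun i j => (M ^ n) (φ i) (s j)) =
      (((Matrix.of fun i j => g i (s j + n * γ)) * Matrix.diagonal fun j =>
        Real.exp (-∫ u in (0 : ℝ)..s j, α u) * Real.exp (-∫ u in (0 : ℝ)..γ, α u) ^ n).map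
          Complex.ofRealHom) := by
    ext i j
    have h := hM.exp_smul_pow_apply hγ hα hαper hbl hbper hb n (hg i).ofReal (hφ i) (s j)
    rw [Matrix.map_apply, Matrix.mul_diagonal, Matrix.of_apply, Matrix.of_apply]
    have h2 : (M ^ n) (φ i) (s j) = Real.exp (-∫ u in (0 : ℝ)..s j, α u) •
        Real.exp (∫ u in (0 : ℝ)..s j, α u) • (M ^ n) (φ i) (s j) := by
      rw [smul_smul, ← Real.exp_add, neg_add_cancel, Real.exp_zero, one_smul]
    rw [h2, h, smul_smul, Complex.real_smul, Complex.ofRealHom_eq_coe, ← Complex.ofReal_mul,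
      mul_comm]
  rw [sampleDetMap_apply, h, ← RingHom.mapMatrix_apply, ← RingHom.map_det, Complex.ofRealHom_eq_coe,
    Complex.norm_real, Real.norm_eq_abs, Matrix.det_mul, Matrix.det_diagonal, abs_mul,
    Finset.prod_mul_distrib, Finset.prod_const, Finset.card_univ, Fintype.card_fin,
    abs_of_pos (mul_pos (Finset.prod_pos fun _ _ => Real.exp_pos _)
      (pow_pos (pow_pos (Real.exp_pos _) _) _)), mul_comm, pow_right_comm]
  rfl

theorem IsOrderedEnumExt.exp_le_prod_norm {M : CC →L[ℂ] CC} {Λ : ℕ → ℂ}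
    (hΛ : IsOrderedEnumExt M Λ) (hM : IsMonodromy α β γ M) (hγ : 0 < γ)
    (hα : LocallyIntegrable α) (hαper : ∀ᵐ t, α (t + γ) = α t) (hbl : LocallyIntegrable b)
    (hbper : ∀ᵐ t, b (t + γ) = b t)
    (hb : ∀ t, b t = β t * Real.exp (∫ s in (t - 1)..t, α s)) {b₀ : ℝ} {ζ : ℕ → ℂ}
    (hζ : IsRootEnum b₀ ζ) {k : ℕ} (hk : 1 ≤ k) (hb₀ : 0 < (-1) ^ k * b₀)
    (hbb : ∀ᵐ u, (-1) ^ k * b₀ ≤ (-1) ^ k * b u) :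
    Real.exp (-∫ u in (0 : ℝ)..γ, α u) ^ k * Real.exp (γ * ∑ j ∈ Finset.Icc 1 k, (ζ j).re) ≤
      ∏ j ∈ Finset.Icc 1 k, ‖Λ j‖ := by
  have hA := hα.continuous_integral 0
  choose g hg hg0 using fun i : Fin k => exists_isDelaySolution hbl
    (φ := fun t : ℝ => t ^ (i : ℕ)) (by fun_prop)
  obtain ⟨s, hs, c, hc, hcs⟩ := hζ.exists_le_sampleDet hbl hk hb₀ hbb hg
    fun i θ hθ => hg0 i θ hθ.2
  let s' : Fin k → I01 := fun j => ⟨s j, hs j⟩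
  let φ : Fin k → CC := fun i => ⟨fun θ : I01 =>
    ((Real.exp (-∫ u in (0 : ℝ)..θ, α u) * (θ : ℝ) ^ (i : ℕ) : ℝ) : ℂ), by
      have := hA.comp (continuous_subtype_val (p := fun x => x ∈ I01))
      simp only [Function.comp_def] at this
      fun_prop⟩
  have hφ : ∀ i (θ : I01), (g i θ : ℂ) = Real.exp (∫ s in (0 : ℝ)..θ, α s) • φ i θ := by
    intro i θ
    change (g i θ : ℂ) = Real.exp (∫ s in (0 : ℝ)..θ, α s) •
      ((Real.exp (-∫ u in (0 : ℝ)..θ, α u) * (θ : ℝ) ^ (i : ℕ) : ℝ) : ℂ)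
    rw [hg0 i θ θ.2.2, Complex.real_smul, ← Complex.ofReal_mul, ← mul_assoc, ← Real.exp_add,
      add_neg_cancel, Real.exp_zero, one_mul]
  obtain ⟨N, hN⟩ := exists_nat_ge (1 / γ)
  have hN' : 1 ≤ N * γ := (div_le_iff₀ hγ).1 hN
  have hN0 : N ≠ 0 := by
    rintro rfl
    norm_num at hN'
  have : Nonempty I01 := ⟨⟨0, by norm_num⟩⟩
  have hcpt := hM.isCompactOperator_pow hγ.le hα hαper hbl hbper hb hN'
  set q := Real.exp (-∫ u in (0 : ℝ)..γ, α u) ^ k with hq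
  set w := Real.exp (γ * ∑ j ∈ Finset.Icc 1 k, (ζ j).re) with hw
  have hε : ∀ ε : ℝ, 0 < ε → q * w ≤ ∏ j ∈ Finset.Icc 1 k, (‖Λ j‖ + ε) := by
    intro ε hε
    obtain ⟨C, hC⟩ := norm_alternatingMap_pow_le hN0 hcpt Λ hΛ.1
      (fun j hj => (hΛ.2.1 j hj).imp_right fun h => (isFloquetMult_iff_hasEigenvalue.1 h).2)
      (fun μ hμ0 hμ => by
        rw [hΛ.2.2 μ (isFloquetMult_iff_hasEigenvalue.2 ⟨hμ0, hμ⟩), algMult,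
          genEig_eq_maxGenEigenspace])
      hk hε (sampleDetMap s') (norm_sampleDetMap_le s') φ
    refine le_of_forall_mul_pow_le (Finset.prod_pos fun j _ => by positivity)
      (mul_pos (Finset.prod_pos fun (j : Fin k) (_ : j ∈ Finset.univ) =>
        Real.exp_pos (-∫ u in (0 : ℝ)..s j, α u)) hc)
      fun n => le_trans ?_ (hC n)
    rw [hM.norm_sampleDetMap_pow hγ.le hα hαper hbl hbper hb n hg hφ s', ← hq]
    have h := (hcs (n * γ) (by positivity)).trans (le_abs_self _)
    rw [mul_assoc (n : ℝ), Real.exp_nat_mul, ← hw] at h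
    calc _ = (∏ j, Real.exp (-∫ u in (0 : ℝ)..s j, α u)) * q ^ n * (c * w ^ n) := by
          rw [mul_pow]
          ring
      _ ≤ _ := mul_le_mul_of_nonneg_left h (by positivity)
  have hcont : Continuous fun ε : ℝ => ∏ j ∈ Finset.Icc 1 k, (‖Λ j‖ + ε) := by fun_prop
  have hlim := (hcont.tendsto 0).mono_left (nhdsWithin_le_nhds (s := Set.Ioi 0))
  simp only [add_zero] at hlim
  exact ge_of_tendsto hlim (eventually_nhdsWithin_of_forall hε)

theorem IsOrderedEnumExt.le_norm {M : CC →L[ℂ] CC} {Λ : ℕ → ℂ}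
    (hΛ : IsOrderedEnumExt M Λ) (hM : IsMonodromy α β γ M) (hγ : 0 < γ)
    (hα : LocallyIntegrable α) (hαper : ∀ᵐ t, α (t + γ) = α t) (hbl : LocallyIntegrable b)
    (hbper : ∀ᵐ t, b (t + γ) = b t)
    (hb : ∀ t, b t = β t * Real.exp (∫ s in (t - 1)..t, α s)) {b₀ : ℝ} {ζ : ℕ → ℂ}
    (hζ : IsRootEnum b₀ ζ) {k : ℕ} (hk : 1 ≤ k) (hb₀ : 0 < (-1) ^ k * b₀)
    (hbb : ∀ᵐ u, (-1) ^ k * b₀ ≤ (-1) ^ k * b u) :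
    (Real.exp (∫ s in (0 : ℝ)..γ, |b s|) ^ (k - 1))⁻¹ *
      Real.exp ((-∫ u in (0 : ℝ)..γ, α u) + γ * ∑ j ∈ Finset.Icc 1 k, (ζ j).re) ≤ ‖Λ k‖ := by
  have h := hΛ.exp_le_prod_norm hM hγ hα hαper hbl hbper hb hζ hk hb₀ hbb
  obtain ⟨l, rfl⟩ := Nat.exists_eq_add_of_le' hk
  have hle : ∏ j ∈ Finset.Icc 1 l, ‖Λ j‖ ≤ (Real.exp (∫ s in (0 : ℝ)..γ, |b s|) *
      Real.exp (-∫ s in (0 : ℝ)..γ, α s)) ^ l := by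
    refine (Finset.prod_le_prod (fun _ _ => norm_nonneg _) fun j hj => ?_).trans_eq
      ((Finset.prod_const _).trans (by rw [Nat.card_Icc, add_tsub_cancel_right]))
    rcases hΛ.2.1 j (Finset.mem_Icc.1 hj).1 with h0 | h0
    · rw [h0, norm_zero]
      positivity
    · exact hM.norm_le_of_isFloquetMult hγ hα hαper hbl hbper hb h0
  rw [Finset.prod_Icc_succ_top (by omega)] at h
  have h' := h.trans (mul_le_mul_of_nonneg_right hle (norm_nonneg _))
  rw [Real.exp_add, add_tsub_cancel_right, inv_mul_le_iff₀ (by positivity)]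
  have he : 0 < Real.exp (-∫ s in (0 : ℝ)..γ, α s) ^ l := by positivity
  refine le_of_mul_le_mul_left ?_ he
  calc _ = _ := by rw [← mul_assoc, ← pow_succ]
    _ ≤ _ := h'
    _ = _ := by rw [mul_pow]; ring

end Assembly

theorem statement7 (α β : ℝ → ℝ)
    (hα : LocallyIntegrable α volume) (hβ : LocallyIntegrable β volume)
    (γ : ℝ) (hγ : 0 < γ)
    (hαper : ∀ᵐ t ∂volume, α (t + γ) = α t) (hβper : ∀ᵐ t ∂volume, β (t + γ) = β t)
    (b : ℝ → ℝ) (hb : b = fun t => β t * Real.exp (∫ s in (t - 1)..t, α s))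
    (m : ℤ) (b₀ : ℝ) (hb₀ : 0 < (-1 : ℝ) ^ m * b₀)
    (hsign : ∀ᵐ t ∂volume, (-1 : ℝ) ^ m * b₀ ≤ (-1 : ℝ) ^ m * b t)
    (M : CC →L[ℂ] CC) (hM : IsMonodromy α β γ M)
    (Λ : ℕ → ℂ) (hΛ : IsOrderedEnumExt M Λ)
    (ζ : ℕ → ℂ) (hζ : IsRootEnum b₀ ζ)
    (α₀ Q : ℝ) (hα₀ : α₀ = (1 / γ) * ∫ s in (0:ℝ)..γ, α s)
    (hQ : Q = Real.exp (∫ s in (0:ℝ)..γ, |b s|)) :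
    (∀ k : ℕ, 1 ≤ k → Even ((k : ℤ) - m) →
      Q ^ (-((k : ℤ) - 1)) *
          Real.exp (-(γ * α₀) + γ * ∑ j ∈ Finset.Icc 1 k, (ζ j).re) ≤
        ‖Λ k‖) ∧
    ∀ k : ℕ, 1 ≤ k → Λ k ≠ 0 := by
  have hb' : ∀ t, b t = β t * Real.exp (∫ s in (t - 1)..t, α s) := congrFun hb
  have hbl := locallyIntegrable_coefficient hα hβ hb'
  have hbper := ae_coefficient_add_period hαper hβper hb'
  have hγα : γ * α₀ = ∫ s in (0:ℝ)..γ, α s := by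
    rw [hα₀, ← mul_assoc, mul_one_div_cancel hγ.ne', one_mul]
  have hmain : ∀ k : ℕ, 1 ≤ k → Even ((k : ℤ) - m) →
      Q ^ (-((k : ℤ) - 1)) *
          Real.exp (-(γ * α₀) + γ * ∑ j ∈ Finset.Icc 1 k, (ζ j).re) ≤ ‖Λ k‖ := by
    intro k hk heven
    have hpow : (-1 : ℝ) ^ m = (-1) ^ k := by
      have h := zpow_add₀ (show (-1 : ℝ) ≠ 0 by norm_num) ((k : ℤ) - m) m
      rw [heven.neg_one_zpow, one_mul, sub_add_cancel, zpow_natCast] at h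
      exact h.symm
    rw [hpow] at hb₀ hsign
    have h := hΛ.le_norm hM hγ hα hαper hbl hbper hb' hζ hk hb₀ hsign
    rwa [hγα, zpow_neg, ← Nat.cast_pred hk, zpow_natCast, hQ]
  have hQ0 : 0 < Q := hQ ▸ Real.exp_pos _
  have hpos : ∀ k : ℕ, 1 ≤ k → Even ((k : ℤ) - m) → 0 < ‖Λ k‖ := fun k hk heven =>
    lt_of_lt_of_le (by positivity) (hmain k hk heven)
  refine ⟨hmain, fun k hk => norm_pos_iff.1 ?_⟩
  rcases Int.even_or_odd ((k : ℤ) - m) with h | h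
  · exact hpos k hk h
  · refine (hpos (k + 1) (by omega) ?_).trans_le (hΛ.1 k hk)
    rw [Nat.cast_succ, add_sub_right_comm]
    exact h.add_one
end
end

section
/- Let n ≥ 1 be an integer and let Q, B > 0, and set C = n·(2^n − 1)^n·Q^{n−1}·B^{−n}. Then for every n-dimensional real normed vector space E and every invertible linear map L : E → E whose operator norm satisfies ‖L‖ ≤ Q and all of whose eigenvalues λ ∈ ℂ (the complex roots of the characteristic polynomial of L) satisfy |λ| ≥ B, one has ‖L^{−1}‖ ≤ C. In particular, the bound C depends only on n, Q, and B, and not on the particular norm with which E is endowed. -/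
/-- A nonnegative sequence `r ^ k * a` dominated by a geometric sequence of positive ratio `q`
has `r ≤ q`. -/
theorem le_of_forall_pow_mul_le {r q a K : ℝ} (hq : 0 < q) (ha : 0 < a)
    (h : ∀ k : ℕ, r ^ k * a ≤ K * q ^ k) : r ≤ q := by
  by_contra! hlt
  obtain ⟨k, hk⟩ := pow_unbounded_of_one_lt (K / a) ((one_lt_div hq).2 hlt)
  rw [div_pow, div_lt_div_iff₀ ha (pow_pos hq k)] at hk
  exact absurd (h k) (not_le.2 hk)

/-- Complex eigenvalues of an operator on a finite-dimensional real normed space are bounded by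
its operator norm. -/
theorem norm_le_of_isRoot_charpoly {E : Type*} [NormedAddCommGroup E] [NormedSpace ℝ E]
    [FiniteDimensional ℝ E] {L : E →L[ℝ] E} {Q : ℝ} (hQ : 0 < Q) (hL : ‖L‖ ≤ Q) {z : ℂ}
    (hz : ((LinearMap.charpoly (L : E →ₗ[ℝ] E)).map (algebraMap ℝ ℂ)).IsRoot z) :
    ‖z‖ ≤ Q := by
  rw [← LinearMap.charpoly_baseChange, ← Module.End.hasEigenvalue_iff_isRoot_charpoly] at hz
  obtain ⟨v, hv⟩ := hz.exists_hasEigenvector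
  let e := (Module.finBasis ℂ (TensorProduct ℝ ℂ E)).equivFun
  let φ : (E →L[ℝ] E) →ₗ[ℝ] (Fin (Module.finrank ℂ (TensorProduct ℝ ℂ E)) → ℂ) :=
    { toFun := fun S ↦ e ((S : E →ₗ[ℝ] E).baseChange ℂ v)
      map_add' := fun S T ↦ by simp [LinearMap.baseChange_add]
      map_smul' := fun c S ↦ by
        simp only [ContinuousLinearMap.toLinearMap_smul, LinearMap.baseChange_smul,
          LinearMap.smul_apply, RingHom.id_apply]
        rw [← algebraMap_smul ℂ c, map_smul, algebraMap_smul] }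
  have hφ (k : ℕ) : φ (L ^ k) = z ^ k • e v := by
    change e (((L ^ k : E →L[ℝ] E) : E →ₗ[ℝ] E).baseChange ℂ v) = _
    rw [ContinuousLinearMap.toLinearMap_pow, LinearMap.baseChange_pow, hv.pow_apply, map_smul]
  have ha : 0 < ‖e v‖ := norm_pos_iff.2 (e.map_ne_zero_iff.2 hv.2)
  refine le_of_forall_pow_mul_le (K := ‖LinearMap.toContinuousLinearMap φ‖ * ‖(1 : E →L[ℝ] E)‖)
    hQ ha fun k ↦ ?_
  have hpow : ‖L ^ k‖ ≤ ‖(1 : E →L[ℝ] E)‖ * Q ^ k := by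
    induction k with
    | zero => simp
    | succ k ih =>
      rw [pow_succ, pow_succ, ← mul_assoc]
      exact (norm_mul_le _ _).trans (by gcongr)
  calc ‖z‖ ^ k * ‖e v‖ = ‖LinearMap.toContinuousLinearMap φ (L ^ k)‖ := by
        rw [LinearMap.coe_toContinuousLinearMap', hφ, norm_smul, norm_pow]
    _ ≤ ‖LinearMap.toContinuousLinearMap φ‖ * ‖L ^ k‖ := ContinuousLinearMap.le_opNorm _ _
    _ ≤ _ := by rw [mul_assoc]; gcongr

/-- A monic complex polynomial whose roots all have norm at least `B` has constant coefficient of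
norm at least `B ^ natDegree`. -/
theorem pow_natDegree_le_norm_coeff_zero {p : Polynomial ℂ} (hp : p.Monic) {B : ℝ} (hB : 0 ≤ B)
    (h : ∀ z ∈ p.roots, B ≤ ‖z‖) : B ^ p.natDegree ≤ ‖p.coeff 0‖ := by
  have key (s : Multiset ℂ) (hs : ∀ z ∈ s, B ≤ ‖z‖) : B ^ s.card ≤ ‖s.prod‖ := by
    induction s using Multiset.induction_on with
    | empty => simp
    | cons a s ih =>
      rw [Multiset.card_cons, Multiset.prod_cons, norm_mul, pow_succ']
      have := hs a (Multiset.mem_cons_self a s)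
      have := ih fun z hz ↦ hs z (Multiset.mem_cons_of_mem hz)
      gcongr
  have hsp := IsAlgClosed.splits p
  rw [hsp.coeff_zero_eq_prod_roots_of_monic hp, norm_mul, norm_pow, norm_neg, norm_one, one_pow,
    one_mul]
  conv_lhs => rw [hsp.natDegree_eq_card_roots]
  exact key _ h

/-- The sharper bound given directly by the Cayley–Hamilton theorem. -/
theorem norm_inverse_le_of_eigenvalues {Q B : ℝ} (hQ : 0 < Q) (hB : 0 < B)
    {E : Type*} [NormedAddCommGroup E] [NormedSpace ℝ E] [FiniteDimensional ℝ E]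
    (hdim : 1 ≤ Module.finrank ℝ E) {L M : E →L[ℝ] E} (hLM : ∀ v, L (M v) = v)
    (hnorm : ‖L‖ ≤ Q)
    (heig : ∀ z : ℂ,
      ((LinearMap.charpoly (L : E →ₗ[ℝ] E)).map (algebraMap ℝ ℂ)).IsRoot z → B ≤ ‖z‖) :
    ‖M‖ ≤ ((2 : ℝ) ^ Module.finrank ℝ E - 1) * Q ^ (Module.finrank ℝ E - 1) /
      B ^ Module.finrank ℝ E := by
  set n := Module.finrank ℝ E with hn
  set p := LinearMap.charpoly (L : E →ₗ[ℝ] E) with hp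
  have hmonic : p.Monic := LinearMap.charpoly_monic _
  have hdeg : p.natDegree = n := LinearMap.charpoly_natDegree _
  have hcoeff (i : ℕ) : ‖p.coeff i‖ ≤ Q ^ (n - i) * n.choose i := by
    have := Polynomial.coeff_le_of_roots_le (f := algebraMap ℝ ℂ) (B := Q) i hmonic
      (IsAlgClosed.splits _)
      fun z hz ↦ norm_le_of_isRoot_charpoly hQ hnorm (Polynomial.isRoot_of_mem_roots hz)
    simpa [hdeg] using this
  have hzero : B ^ n ≤ ‖p.coeff 0‖ := by
    have := pow_natDegree_le_norm_coeff_zero (hmonic.map (algebraMap ℝ ℂ)) hB.le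
      fun z hz ↦ heig z (Polynomial.isRoot_of_mem_roots hz)
    simpa [hdeg] using this
  have hpow (i : ℕ) (v : E) : ‖((L : E →ₗ[ℝ] E) ^ i) v‖ ≤ Q ^ i * ‖v‖ := by
    induction i with
    | zero => simp
    | succ i ih =>
      rw [pow_succ', Module.End.mul_apply, pow_succ', mul_assoc]
      exact (L.le_of_opNorm_le hnorm _).trans (by gcongr)
  have hchoose : ∑ i ∈ Finset.range n, (n.choose (i + 1) : ℝ) = 2 ^ n - 1 := by
    have := Nat.sum_range_choose n
    rw [Finset.sum_range_succ', Nat.choose_zero_right] at this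
    rw [eq_sub_iff_add_eq]
    exact_mod_cast this
  have htwo : (0 : ℝ) ≤ 2 ^ n - 1 := sub_nonneg.2 (one_le_pow₀ one_le_two)
  refine M.opNorm_le_bound (by positivity) fun v ↦ ?_
  have hCH : ∑ i ∈ Finset.range n, p.coeff (i + 1) • ((L : E →ₗ[ℝ] E) ^ i) v +
      p.coeff 0 • M v = 0 := by
    have h := LinearMap.congr_fun (LinearMap.aeval_self_charpoly (L : E →ₗ[ℝ] E)) (M v)
    rw [← hp, Polynomial.aeval_eq_sum_range, hdeg, Finset.sum_range_succ'] at h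
    simpa [pow_succ, hLM] using h
  rw [div_mul_eq_mul_div, le_div_iff₀ (by positivity), mul_comm]
  calc B ^ n * ‖M v‖ ≤ ‖p.coeff 0 • M v‖ := by rw [norm_smul]; gcongr
    _ = ‖∑ i ∈ Finset.range n, p.coeff (i + 1) • ((L : E →ₗ[ℝ] E) ^ i) v‖ := by
        rw [eq_neg_of_add_eq_zero_left hCH, norm_neg]
    _ ≤ ∑ i ∈ Finset.range n, (n.choose (i + 1) : ℝ) * (Q ^ (n - 1) * ‖v‖) := by
        refine norm_sum_le_of_le _ fun i hi ↦ ?_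
        have hexp : n - 1 = (n - (i + 1)) + i := by
          have := Finset.mem_range.1 hi
          omega
        rw [norm_smul, hexp, pow_add]
        calc _ ≤ (Q ^ (n - (i + 1)) * n.choose (i + 1)) * (Q ^ i * ‖v‖) := by
              gcongr
              exacts [hcoeff _, hpow _ _]
          _ = _ := by ring
    _ = (2 ^ n - 1) * Q ^ (n - 1) * ‖v‖ := by rw [← Finset.sum_mul, hchoose, mul_assoc]


/-- A bound, depending only on `n`, `Q` and `B` (and not on the norm of `E`), for the
norm of the inverse of an invertible linear operator `L` on an `n`-dimensional real
normed space with `‖L‖ ≤ Q` whose complex eigenvalues all satisfy `|λ| ≥ B`. -/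
theorem statement9 (n : ℕ) (hn : 1 ≤ n) (Q B : ℝ) (hQ : 0 < Q) (hB : 0 < B)
    (E : Type*) [NormedAddCommGroup E] [NormedSpace ℝ E] [FiniteDimensional ℝ E]
    (hdim : Module.finrank ℝ E = n)
    (L M : E →L[ℝ] E) (hML : ∀ v, M (L v) = v) (hLM : ∀ v, L (M v) = v)
    (hnorm : ‖L‖ ≤ Q)
    (heig : ∀ z : ℂ,
      ((LinearMap.charpoly (L : E →ₗ[ℝ] E)).map (algebraMap ℝ ℂ)).IsRoot z →
        B ≤ ‖z‖) :
    ‖M‖ ≤ (n : ℝ) * ((2 : ℝ) ^ n - 1) ^ n * Q ^ (n - 1) / B ^ n := by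

  subst hdim
  have htwo : (1 : ℝ) ≤ 2 ^ Module.finrank ℝ E - 1 := by
    have : (2 : ℝ) ^ 1 ≤ 2 ^ Module.finrank ℝ E := pow_le_pow_right₀ one_le_two hn
    linarith
  refine (norm_inverse_le_of_eigenvalues hQ hB hn hLM hnorm heig).trans ?_
  gcongr
  calc (2 : ℝ) ^ Module.finrank ℝ E - 1 ≤ (2 ^ Module.finrank ℝ E - 1) ^ Module.finrank ℝ E :=
        le_self_pow₀ htwo (by omega)
    _ ≤ _ := le_mul_of_one_le_left (by positivity) (by exact_mod_cast hn)
end
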